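/- For every prime number p, there exist number fields L₁ and L₂ that are not isomorphic as fields, a central division algebra A₁ of degree p over L₁ and a central division algebra A₂ of degree p over L₂, such that: (i) for every finite-dimensional central simple ℚ-algebra B, B lies in the fiber (Res_{L₁/ℚ})⁻¹(A₁) if and only if B lies in the fiber (Res_{L₂/ℚ})⁻¹(A₂); and (ii) there are infinitely many pairwise non-Brauer-equivalent finite-dimensional central simple ℚ-algebras lying in the fiber (Res_{L₁/ℚ})⁻¹(A₁). -/

import Mathlib

open TensorProduct

/-- A bundled finite-dimensional central simple algebra over the field `k`. -/
structure CSAlg (k : Type) [Field k] : Type 1 where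
  carrier : Type
  [ring : Ring carrier]
  [alg : Algebra k carrier]
  finiteDimensional : FiniteDimensional k carrier
  isSimpleRing : IsSimpleRing carrier
  center_le_bot : Subalgebra.center k carrier ≤ ⊥

attribute [instance] CSAlg.ring CSAlg.alg

/-- `A` is a division algebra. -/
def CSAlg.IsDivision {k : Type} [Field k] (A : CSAlg k) : Prop :=
  ∀ x : A.carrier, x ≠ 0 → IsUnit x

/-- `A` has degree `d`, i.e. dimension `d ^ 2` over the base field. -/
def CSAlg.DegreeEq {k : Type} [Field k] (A : CSAlg k) (d : ℕ) : Prop :=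
  Module.finrank k A.carrier = d ^ 2

/-- Brauer equivalence of two `k`-algebras: some matrix algebras over them are
isomorphic as `k`-algebras. -/
def IsBrauerEquiv (k : Type) [Field k] (A : Type) [Ring A] [Algebra k A]
    (B : Type) [Ring B] [Algebra k B] : Prop :=
  ∃ n m : ℕ, 0 < n ∧ 0 < m ∧
    Nonempty (Matrix (Fin n) (Fin n) A ≃ₐ[k] Matrix (Fin m) (Fin m) B)

/-- A central simple `F`-algebra `B` lies in the fiber `(Res_{K/F})⁻¹(A)` if
`B ⊗[F] K` is Brauer-equivalent to `A` over `K`. -/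
def InFiber (F : Type) [Field F] (K : Type) [Field K] [Algebra F K]
    (A : CSAlg K) (B : CSAlg F) : Prop :=
  IsBrauerEquiv K (K ⊗[F] B.carrier) A.carrier

/-- A bundled number field. -/
structure NumField : Type 1 where
  carrier : Type
  [field : Field carrier]
  [numberField : NumberField carrier]

attribute [instance] NumField.field NumField.numberField

namespace CentralSimple

section General

variable {K : Type} [Field K]

/-- An algebra homomorphism out of a simple algebra into an algebra of the same finite dimension is
bijective. -/
theorem bijective_of_finrank_eq {A B : Type} [Ring A] [Algebra K A] [Ring B] [Algebra K B]
    [IsSimpleRing A] [Nontrivial B] [FiniteDimensional K A] [FiniteDimensional K B]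
    (f : A →ₐ[K] B) (h : Module.finrank K A = Module.finrank K B) : Function.Bijective f := by
  have hi : Function.Injective f.toLinearMap := RingHom.injective (f : A →+* B)
  exact ⟨hi, (LinearMap.injective_iff_surjective_of_finrank_eq_finrank h).1 hi⟩

theorem mulLeftRight_surjective (B : Type) [Ring B] [Algebra K B] [FiniteDimensional K B]
    [IsSimpleRing B] [Algebra.IsCentral K B] :
    Function.Surjective (AlgHom.mulLeftRight K B) := by
  let _ : Module (B ⊗[K] Bᵐᵒᵖ) B := TensorProduct.Algebra.module
  have hsmul : ∀ (r : B ⊗[K] Bᵐᵒᵖ) (x : B), r • x = AlgHom.mulLeftRight K B r x :=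
    fun _ _ ↦ rfl
  have hsimple : IsSimpleModule (B ⊗[K] Bᵐᵒᵖ) B := by
    rw [isSimpleModule_iff_toSpanSingleton_surjective]
    refine ⟨inferInstance, fun x hx y ↦ ?_⟩
    have h1 : (1 : B) ∈ TwoSidedIdeal.span {x} :=
      IsSimpleRing.one_mem_of_ne_zero_mem (TwoSidedIdeal.span {x}) hx
        (TwoSidedIdeal.subset_span (by simp))
    have hy : y ∈ TwoSidedIdeal.span {x} := by
      simpa using TwoSidedIdeal.mul_mem_left _ y _ h1
    let N : Submodule (B ⊗[K] Bᵐᵒᵖ) B :=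
      LinearMap.range (LinearMap.toSpanSingleton (B ⊗[K] Bᵐᵒᵖ) B x)
    let I : TwoSidedIdeal B := TwoSidedIdeal.mk' (N : Set B) N.zero_mem
      (fun h h' ↦ N.add_mem h h') (fun h ↦ N.neg_mem h)
      (fun {a b} h ↦ by
        have := N.smul_mem (a ⊗ₜ 1) h
        simpa [hsmul] using this)
      (fun {a b} h ↦ by
        have := N.smul_mem (1 ⊗ₜ (MulOpposite.op b)) h
        simpa [hsmul] using this)
    have hxI : x ∈ I := by
      have : x ∈ N := ⟨1, by simp⟩
      simpa [I] using! this
    have hle : TwoSidedIdeal.span {x} ≤ I := by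
      rw [TwoSidedIdeal.span_le]
      simpa using hxI
    have := hle hy
    have hyN : y ∈ N := by simpa [I] using! this
    exact hyN
  intro f
  have hlin : ∀ (g : Module.End (B ⊗[K] Bᵐᵒᵖ) B), ∃ c : K, ∀ x, g x = c • x := by
    intro g
    have hl : ∀ a x, g (a * x) = a * g x := fun a x ↦ by
      have := g.map_smul (a ⊗ₜ 1) x
      simpa [hsmul] using this
    have hr : ∀ a x, g (x * a) = g x * a := fun a x ↦ by
      have := g.map_smul (1 ⊗ₜ (MulOpposite.op a)) x
      simpa [hsmul] using this
    have hc : g 1 ∈ Subalgebra.center K B := by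
      rw [Subalgebra.mem_center_iff]
      intro b
      rw [← hl b 1, ← hr b 1]; simp
    rw [Algebra.IsCentral.center_eq_bot, Algebra.mem_bot] at hc
    obtain ⟨c, hc⟩ := hc
    refine ⟨c, fun x ↦ ?_⟩
    have := hr x 1
    rw [one_mul] at this
    rw [this, ← hc, Algebra.smul_def]
  let F : Module.End (Module.End (B ⊗[K] Bᵐᵒᵖ) B) B :=
    { toFun := f
      map_add' := f.map_add
      map_smul' := fun g x ↦ by
        obtain ⟨c, hc⟩ := hlin g
        simp [hc] }
  let b := Module.finBasis K B
  classical
  obtain ⟨r, hr⟩ := jacobson_density F (Finset.univ.image b)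
  refine ⟨r, b.ext fun i ↦ ?_⟩
  exact (hr (b i) (by simp)).symm

theorem mulLeftRight_bijective (B : Type) [Ring B] [Algebra K B] [FiniteDimensional K B]
    [IsSimpleRing B] [Algebra.IsCentral K B] :
    Function.Bijective (AlgHom.mulLeftRight K B) := by
  have h : Module.finrank K (B ⊗[K] Bᵐᵒᵖ) = Module.finrank K (Module.End K B) := by
    rw [Module.finrank_tensorProduct, Module.finrank_linearMap,
      (MulOpposite.opLinearEquiv K (M := B)).finrank_eq]
  have hs := mulLeftRight_surjective (K := K) B
  exact ⟨(LinearMap.injective_iff_surjective_of_finrank_eq_finrank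
    (f := (AlgHom.mulLeftRight K B).toLinearMap) h).2 hs, hs⟩

/-- The tensor product of a simple algebra with a central simple algebra is simple. -/
theorem isSimpleRing_tensor (A B : Type) [Ring A] [Algebra K A] [IsSimpleRing A]
    [Ring B] [Algebra K B] [FiniteDimensional K B] [IsSimpleRing B] [Algebra.IsCentral K B] :
    IsSimpleRing (A ⊗[K] B) := by
  apply IsSimpleRing.of_eq_bot_or_eq_top
  intro I
  by_cases hI : I = ⊥
  · exact Or.inl hI
  right
  obtain ⟨u, hu, hu0⟩ : ∃ u ∈ I, u ≠ 0 := by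
    by_contra! h
    apply hI
    ext x
    rw [TwoSidedIdeal.mem_bot]
    exact ⟨h x, fun hx ↦ hx ▸ I.zero_mem⟩
  have hstable : ∀ f : Module.End K B, LinearMap.lTensor A f u ∈ I := by
    intro f
    obtain ⟨r, rfl⟩ := mulLeftRight_surjective B f
    induction r using TensorProduct.induction_on with
    | zero => simp
    | add x y hx hy =>
      rw [map_add, LinearMap.lTensor_add]
      exact I.add_mem hx hy
    | tmul x y =>
      have : LinearMap.lTensor A (AlgHom.mulLeftRight K B (x ⊗ₜ[K] y)) u
          = ((1 : A) ⊗ₜ[K] x) * u * ((1 : A) ⊗ₜ[K] y.unop) := by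
        clear hu hu0
        induction u using TensorProduct.induction_on with
        | zero => simp
        | add a b ha hb => rw [map_add, ha, hb, mul_add, add_mul]
        | tmul a b => simp
      rw [this]
      exact I.mul_mem_right _ _ (I.mul_mem_left _ _ hu)
  let b := Module.finBasis K B
  obtain ⟨i, hi⟩ : ∃ i, TensorProduct.equivFinsuppOfBasisRight b u i ≠ (0 : A) := by
    by_contra! h
    apply hu0
    apply (TensorProduct.equivFinsuppOfBasisRight (M := A) b).injective
    ext i
    simpa using h i
  set a : A := TensorProduct.equivFinsuppOfBasisRight b u i with ha
  have key : ∀ w : A ⊗[K] B, (TensorProduct.equivFinsuppOfBasisRight b w i) ⊗ₜ[K] (1 : B) =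
      LinearMap.lTensor A ((LinearMap.toSpanSingleton K B 1) ∘ₗ (b.coord i)) w := by
    intro w
    induction w using TensorProduct.induction_on with
    | zero => simp
    | add x y hx hy => rw [map_add, map_add, ← hx, ← hy, ← TensorProduct.add_tmul]; rfl
    | tmul x y => simp [TensorProduct.smul_tmul]
  have ha1 : a ⊗ₜ[K] (1 : B) ∈ I := by
    rw [ha, key]
    exact hstable _
  have h1 : (1 : A) ∈
      TwoSidedIdeal.comap (Algebra.TensorProduct.includeLeft : A →ₐ[K] A ⊗[K] B) I :=
    IsSimpleRing.one_mem_of_ne_zero_mem _ hi (by simpa [TwoSidedIdeal.mem_comap] using ha1)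
  rw [TwoSidedIdeal.mem_comap] at h1
  rw [← TwoSidedIdeal.one_mem_iff]
  simpa [Algebra.TensorProduct.one_def] using h1

theorem center_baseChange (L : Type) [Field L] [Algebra K L] (B : Type) [Ring B] [Algebra K B]
    [Algebra.IsCentral K B] : Algebra.IsCentral L (L ⊗[K] B) := by
  constructor
  intro z hz
  rw [Subalgebra.mem_center_iff] at hz
  have h1 : z ∈ Subalgebra.centralizer K
      ((Algebra.TensorProduct.includeRight : B →ₐ[K] L ⊗[K] B).range : Set (L ⊗[K] B)) := by
    rw [Subalgebra.mem_centralizer_iff]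
    intro g _
    exact hz g
  rw [Subalgebra.centralizer_range_includeRight_eq_center_tensorProduct] at h1
  obtain ⟨w, rfl⟩ := h1
  clear hz
  induction w using TensorProduct.induction_on with
  | zero => simp
  | tmul x y =>
    have hy : (y : B) ∈ (⊥ : Subalgebra K B) := by
      rw [← Algebra.IsCentral.center_eq_bot K B]; exact y.2
    obtain ⟨c, hc⟩ := Algebra.mem_bot.1 hy
    refine Algebra.mem_bot.2 ⟨c • x, ?_⟩
    change (c • x) ⊗ₜ[K] (1 : B) = x ⊗ₜ[K] (y : B)
    rw [← hc, Algebra.algebraMap_eq_smul_one, TensorProduct.smul_tmul]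
  | add x y hx hy => rw [map_add]; exact add_mem hx hy

/-- The tensor product of two central algebras is central. -/
theorem isCentral_tensor (A B : Type) [Ring A] [Algebra K A] [Ring B] [Algebra K B]
    [Nontrivial B] [Algebra.IsCentral K A] [Algebra.IsCentral K B] :
    Algebra.IsCentral K (A ⊗[K] B) := by
  constructor
  intro z hz
  rw [Subalgebra.mem_center_iff] at hz
  have h1 : z ∈ Subalgebra.centralizer K
      ((Algebra.TensorProduct.includeRight : B →ₐ[K] A ⊗[K] B).range : Set (A ⊗[K] B)) := by
    rw [Subalgebra.mem_centralizer_iff]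
    intro g _
    exact hz g
  rw [Subalgebra.centralizer_range_includeRight_eq_center_tensorProduct] at h1
  have h2 : z ∈ (Algebra.TensorProduct.includeLeft : A →ₐ[K] A ⊗[K] B).range := by
    obtain ⟨w, rfl⟩ := h1
    clear hz
    induction w using TensorProduct.induction_on with
    | zero => simp
    | tmul x y =>
      have hy : (y : B) ∈ (⊥ : Subalgebra K B) := by
        rw [← Algebra.IsCentral.center_eq_bot K B]; exact y.2
      obtain ⟨c, hc⟩ := Algebra.mem_bot.1 hy
      refine ⟨c • x, ?_⟩
      simp [← hc, Algebra.algebraMap_eq_smul_one]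
    | add x y hx hy => rw [map_add]; exact add_mem hx hy
  obtain ⟨a, rfl⟩ := h2
  have ha : a ∈ Subalgebra.center K A := by
    rw [Subalgebra.mem_center_iff]
    intro b
    have := hz (b ⊗ₜ 1)
    have this : (b * a) ⊗ₜ[K] (1 : B) = (a * b) ⊗ₜ[K] (1 : B) := by
      simpa using this
    exact Algebra.TensorProduct.includeLeft_injective (S := K) (A := A) (B := B)
      (algebraMap K B).injective this
  rw [Algebra.IsCentral.center_eq_bot, Algebra.mem_bot] at ha
  obtain ⟨c, rfl⟩ := ha
  exact Algebra.mem_bot.2 ⟨c, by simp [Algebra.TensorProduct.algebraMap_apply]⟩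

end General
end CentralSimple

namespace CentralSimple

section General

variable {K : Type} [Field K]

/-- If a matrix algebra of size `n` acts on `V`, then there is a subspace of dimension
`finrank V / n` that is stable under every action commuting with that of the matrix algebra. -/
theorem exists_cut {n : ℕ} (hn : 0 < n) {V : Type} [AddCommGroup V] [Module K V]
    [FiniteDimensional K V] (f : Matrix (Fin n) (Fin n) K →ₐ[K] Module.End K V) :
    ∃ W : Submodule K V, n * Module.finrank K W = Module.finrank K V ∧
      ∀ (X : Type) [Ring X] [Algebra K X] (g : X →ₐ[K] Module.End K V),
        (∀ m x, Commute (f m) (g x)) →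
        ∃ g' : X →ₐ[K] Module.End K W, ∀ x w, (g' x w : V) = g x w := by
  let z : Fin n := ⟨0, hn⟩
  let W : Submodule K V := LinearMap.range (f (Matrix.single z z 1))
  have hmul : ∀ a b c d (v : V), f (Matrix.single a b 1) (f (Matrix.single c d 1) v) =
      if b = c then f (Matrix.single a d 1) v else 0 := by
    intro a b c d v
    rw [← Module.End.mul_apply, ← map_mul]
    split_ifs with h
    · subst h; simp
    · simp [Matrix.single_mul_single_of_ne _ _ _ _ h]
  have hWmem : ∀ w : W, f (Matrix.single z z 1) w = w := by
    rintro ⟨_, v, rfl⟩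
    simp [hmul]
  have hsum : ∀ v : V, ∑ i, f (Matrix.single i i 1) v = v := by
    intro v
    rw [← LinearMap.sum_apply, ← map_sum]
    have : (∑ i : Fin n, Matrix.single i i (1 : K)) = 1 := by
      ext a b
      simp [Matrix.sum_apply, Matrix.single_apply, Matrix.one_apply, ite_and]
    simp [this]
  let e : V ≃ₗ[K] (Fin n → W) :=
    { toFun := fun v i ↦ ⟨f (Matrix.single z i 1) v, f (Matrix.single z i 1) v, by simp [hmul]⟩
      map_add' := fun v w ↦ by ext i; simp
      map_smul' := fun c v ↦ by ext i; simp
      invFun := fun w ↦ ∑ i, f (Matrix.single i z 1) (w i)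
      left_inv := fun v ↦ by simp [hmul, hsum]
      right_inv := fun w ↦ by
        ext i
        simp [hmul, hWmem] }
  refine ⟨W, ?_, fun X _ _ g hg ↦ ?_⟩
  · rw [e.finrank_eq, Module.finrank_pi_fintype]; simp
  · have hst : ∀ x, ∀ w ∈ W, g x w ∈ W := by
      rintro x _ ⟨v, rfl⟩
      refine ⟨g x v, ?_⟩
      rw [← Module.End.mul_apply, (hg _ x).eq, Module.End.mul_apply]
    exact ⟨AlgHom.ofLinearMap
      { toFun := fun x ↦ (g x).restrict (hst x)
        map_add' := fun x y ↦ by ext; simp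
        map_smul' := fun c x ↦ by ext; simp } (by ext; simp) (fun x y ↦ by ext; simp),
      fun x w ↦ rfl⟩

theorem exists_cut_matrix {n : ℕ} (hn : 0 < n) {V X : Type} [AddCommGroup V] [Module K V]
    [FiniteDimensional K V] [Ring X] [Algebra K X]
    (f : Matrix (Fin n) (Fin n) X →ₐ[K] Module.End K V) :
    ∃ W : Submodule K V, n * Module.finrank K W = Module.finrank K V ∧
      Nonempty (X →ₐ[K] Module.End K W) := by
  obtain ⟨W, hW, h⟩ := exists_cut hn (f.comp (AlgHom.mapMatrix (Algebra.ofId K X)))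
  refine ⟨W, hW, ?_⟩
  obtain ⟨g, -⟩ := h X (f.comp (Matrix.scalarAlgHom (Fin n) K)) (fun m x ↦ by
    simp only [AlgHom.comp_apply]
    refine Commute.map ?_ f
    simp only [Matrix.scalarAlgHom_apply]
    refine (Matrix.scalar_commute_iff.2 ?_).symm
    ext i j
    simp [Algebra.ofId_apply, Algebra.commutes])
  exact ⟨g⟩

theorem finrank_dvd_of_divisionRing {Δ V : Type} [DivisionRing Δ] [Algebra K Δ] [AddCommGroup V]
    [Module K V] (g : Δ →ₐ[K] Module.End K V) : Module.finrank K Δ ∣ Module.finrank K V := by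
  let _ : Module Δ V := Module.compHom V (g : Δ →+* Module.End K V)
  have : IsScalarTower K Δ V := ⟨fun c d v ↦ by
    change g (c • d) v = c • g d v
    simp⟩
  exact ⟨_, (Module.finrank_mul_finrank K Δ V).symm⟩

/-- A simple algebra of dimension `t ^ 2` acting on spaces of dimensions `t * d₁` and `t * d₂` with
`d₁`, `d₂` coprime is split. -/
theorem split_of_coprime {X V₁ V₂ : Type} [Ring X] [Algebra K X] [IsSimpleRing X]
    [FiniteDimensional K X] [AddCommGroup V₁] [Module K V₁] [FiniteDimensional K V₁]
    [AddCommGroup V₂] [Module K V₂] [FiniteDimensional K V₂]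
    (f₁ : X →ₐ[K] Module.End K V₁) (f₂ : X →ₐ[K] Module.End K V₂) {t d₁ d₂ : ℕ}
    (ht : t ^ 2 = Module.finrank K X) (h₁ : Module.finrank K V₁ = t * d₁)
    (h₂ : Module.finrank K V₂ = t * d₂) (hd : d₁.Coprime d₂) :
    Nonempty (X →ₐ[K] Matrix (Fin t) (Fin t) K) := by
  have : IsArtinianRing X := IsArtinianRing.of_finite K X
  obtain ⟨n, hn, Δ, _, _, _, ⟨e⟩⟩ :=
    IsSimpleRing.exists_algEquiv_matrix_divisionRing_finite K X
  have hn0 : 0 < n := NeZero.pos n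
  have hdvd : ∀ {V : Type} [AddCommGroup V] [Module K V] [FiniteDimensional K V]
      (f : X →ₐ[K] Module.End K V), n * Module.finrank K Δ ∣ Module.finrank K V := by
    intro V _ _ _ f
    obtain ⟨W, hW, ⟨g⟩⟩ := exists_cut_matrix hn0 (X := Δ) (f.comp e.symm.toAlgHom)
    rw [← hW]
    exact Nat.mul_dvd_mul_left _ (finrank_dvd_of_divisionRing g)
  have hdim : n ^ 2 * Module.finrank K Δ = t ^ 2 := by
    rw [ht, e.toLinearEquiv.finrank_eq, Module.finrank_matrix]; simp [sq]
  have hdt : n * Module.finrank K Δ ∣ t := by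
    have := Nat.dvd_gcd (h₁ ▸ hdvd f₁) (h₂ ▸ hdvd f₂)
    rwa [Nat.gcd_mul_left, hd, mul_one] at this
  have hpos : 0 < Module.finrank K Δ := Module.finrank_pos
  have htpos : 0 < t := by
    rcases Nat.eq_zero_or_pos t with h | h
    · subst h; simp at hdim; omega
    · exact h
  have hle := Nat.le_of_dvd htpos hdt
  have hΔ : Module.finrank K Δ = 1 := by
    obtain ⟨k, hk⟩ := hdt
    have h3 : n ^ 2 * Module.finrank K Δ =
        n ^ 2 * Module.finrank K Δ * (Module.finrank K Δ * k ^ 2) := by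
      nth_rw 1 [hdim]; rw [hk]; ring
    have h4 : Module.finrank K Δ * k ^ 2 = 1 := by
      have : 0 < n ^ 2 * Module.finrank K Δ := by positivity
      nlinarith
    exact Nat.eq_one_of_mul_eq_one_right h4
  have hnt : n = t := by
    rw [hΔ, mul_one] at hdim
    exact Nat.pow_left_injective (n := 2) (by norm_num) hdim
  subst hnt
  have hb : Function.Bijective (Algebra.ofId K Δ) := bijective_of_finrank_eq _ (by simp [hΔ])
  exact ⟨(AlgHom.mapMatrix (AlgEquiv.ofBijective _ hb).symm.toAlgHom).comp e.toAlgHom⟩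

end General
end CentralSimple

namespace CentralSimple

section General

variable {K : Type} [Field K]

theorem commute_mapMatrix_scalar {n : ℕ} {A : Type} [Ring A] [Algebra K A]
    (m : Matrix (Fin n) (Fin n) K) (x : A) :
    Commute (AlgHom.mapMatrix (Algebra.ofId K A) m) (Matrix.scalarAlgHom (Fin n) K x) := by
  simp only [Matrix.scalarAlgHom_apply]
  refine (Matrix.scalar_commute_iff.2 ?_).symm
  ext i j
  simp [Algebra.ofId_apply, Algebra.commutes]

theorem commute_lift {A B C : Type} [Ring A] [Algebra K A] [Ring B] [Algebra K B] [Ring C]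
    [Algebra K C] (f : A →ₐ[K] C) (g : B →ₐ[K] C) (h : ∀ x y, Commute (f x) (g y)) (c : C)
    (hf : ∀ x, Commute c (f x)) (hg : ∀ x, Commute c (g x)) (z : A ⊗[K] B) :
    Commute c (Algebra.TensorProduct.lift f g h z) := by
  induction z using TensorProduct.induction_on with
  | zero => simp
  | tmul x y => simpa using (hf x).mul_right (hg y)
  | add x y hx hy => rw [map_add]; exact hx.add_right hy

/-- Commuting actions of `Matₙ(A)` and `Matₘ(B)` on `V` yield an action of `A ⊗ B` on a space of
dimension `finrank V / (n * m)`. -/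
theorem exists_cut_tensor {n m : ℕ} (hn : 0 < n) (hm : 0 < m) {A B V : Type} [Ring A] [Algebra K A]
    [Ring B] [Algebra K B] [AddCommGroup V] [Module K V] [FiniteDimensional K V]
    (l : Matrix (Fin n) (Fin n) A →ₐ[K] Module.End K V)
    (r : Matrix (Fin m) (Fin m) B →ₐ[K] Module.End K V) (hlr : ∀ x y, Commute (l x) (r y)) :
    ∃ W : Type, ∃ (_ : AddCommGroup W) (_ : Module K W), FiniteDimensional K W ∧
      n * (m * Module.finrank K W) = Module.finrank K V ∧
      Nonempty (A ⊗[K] B →ₐ[K] Module.End K W) := by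
  let f₁ : Matrix (Fin n) (Fin n) K →ₐ[K] Module.End K V :=
    l.comp (AlgHom.mapMatrix (Algebra.ofId K A))
  let f₂ : Matrix (Fin m) (Fin m) K →ₐ[K] Module.End K V :=
    r.comp (AlgHom.mapMatrix (Algebra.ofId K B))
  let gA : A →ₐ[K] Module.End K V := l.comp (Matrix.scalarAlgHom (Fin n) K)
  let gB : B →ₐ[K] Module.End K V := r.comp (Matrix.scalarAlgHom (Fin m) K)
  have hAB : ∀ x y, Commute (gA x) (gB y) := fun x y ↦ hlr _ _
  have h1A : ∀ x y, Commute (f₁ x) (gA y) := fun x y ↦ (commute_mapMatrix_scalar x y).map l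
  have h2B : ∀ x y, Commute (f₂ x) (gB y) := fun x y ↦ (commute_mapMatrix_scalar x y).map r
  have h1B : ∀ x y, Commute (f₁ x) (gB y) := fun x y ↦ hlr _ _
  have h2A : ∀ x y, Commute (f₂ x) (gA y) := fun x y ↦ (hlr _ _).symm
  have h12 : ∀ x y, Commute (f₁ x) (f₂ y) := fun x y ↦ hlr _ _
  let g : A ⊗[K] B →ₐ[K] Module.End K V := Algebra.TensorProduct.lift gA gB hAB
  have hg₁ : ∀ x y, Commute (f₁ x) (g y) := fun x y ↦
    commute_lift gA gB hAB _ (h1A x) (h1B x) y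
  have hg₂ : ∀ x y, Commute (f₂ x) (g y) := fun x y ↦
    commute_lift gA gB hAB _ (h2A x) (h2B x) y
  obtain ⟨W, hW, hcut⟩ := exists_cut hn f₁
  obtain ⟨g', hg'⟩ := hcut _ g hg₁
  obtain ⟨f₂', hf₂'⟩ := hcut _ f₂ h12
  obtain ⟨W', hW', hcut'⟩ := exists_cut hm f₂'
  obtain ⟨g'', -⟩ := hcut' _ g' fun x y ↦ by
    ext w
    have := LinearMap.congr_fun (hg₂ x y).eq w
    simp only [Module.End.mul_apply] at this ⊢
    rw [hf₂', hg', hg', hf₂', this]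
  exact ⟨W', inferInstance, inferInstance, inferInstance, by rw [hW', hW], ⟨g''⟩⟩

theorem exists_split_of_isBrauerEquiv {A A' : Type} [Ring A] [Algebra K A] [FiniteDimensional K A]
    [Ring A'] [Algebra K A'] [FiniteDimensional K A'] (h : IsBrauerEquiv K A A') :
    ∃ t, t ^ 2 = Module.finrank K A * Module.finrank K A' ∧
      Nonempty (A ⊗[K] A'ᵐᵒᵖ →ₐ[K] Matrix (Fin t) (Fin t) K) := by
  obtain ⟨n, m, hn, hm, ⟨φ⟩⟩ := h
  let l : Matrix (Fin n) (Fin n) A →ₐ[K] Module.End K (Matrix (Fin m) (Fin m) A') :=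
    (Algebra.lmul K _).comp φ.toAlgHom
  let r₀ : (Matrix (Fin m) (Fin m) A')ᵐᵒᵖ →ₐ[K] Module.End K (Matrix (Fin m) (Fin m) A') :=
    (AlgHom.mulLeftRight K _).comp Algebra.TensorProduct.includeRight
  let r : Matrix (Fin m) (Fin m) A'ᵐᵒᵖ →ₐ[K] Module.End K (Matrix (Fin m) (Fin m) A') :=
    r₀.comp (AlgEquiv.mopMatrix (R := K)).toAlgHom
  have hr : ∀ x y, r₀ x y = y * x.unop := fun x y ↦ by simp [r₀]
  have hl : ∀ x y, l x y = φ x * y := fun x y ↦ by simp [l]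
  have hlr : ∀ x y, Commute (l x) (r₀ y) := fun x y ↦ by
    ext1 z
    simp [hl, hr, mul_assoc]
  obtain ⟨W, _, _, _, hW, ⟨g⟩⟩ := exists_cut_tensor hn hm l r fun x y ↦ hlr _ _
  have hdim : m ^ 2 * Module.finrank K A' = n ^ 2 * Module.finrank K A := by
    have := φ.toLinearEquiv.finrank_eq
    simp only [Module.finrank_matrix, Fintype.card_fin] at this
    rw [sq, sq, this]
  have h0 : n * (m * Module.finrank K W) = m ^ 2 * Module.finrank K A' := by
    rw [hW]
    simp [Module.finrank_matrix, sq]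
  refine ⟨Module.finrank K W, ?_, ⟨(algEquivMatrix (Module.finBasis K W)).toAlgHom.comp g⟩⟩
  have h1 : n ^ 2 * m ^ 2 * Module.finrank K W ^ 2 =
      n ^ 2 * m ^ 2 * (Module.finrank K A * Module.finrank K A') := by
    calc _ = (n * (m * Module.finrank K W)) * (n * (m * Module.finrank K W)) := by ring
      _ = (m ^ 2 * Module.finrank K A') * (n ^ 2 * Module.finrank K A) := by rw [h0, hdim]
      _ = _ := by ring
  exact Nat.eq_of_mul_eq_mul_left (by positivity) h1

theorem isBrauerEquiv_of_split {A A' : Type} [Ring A] [Algebra K A] [FiniteDimensional K A]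
    [IsSimpleRing A] [Ring A'] [Algebra K A'] [FiniteDimensional K A'] [IsSimpleRing A']
    [Algebra.IsCentral K A'] {t : ℕ} (ht : t ^ 2 = Module.finrank K A * Module.finrank K A')
    (ψ : A ⊗[K] A'ᵐᵒᵖ →ₐ[K] Matrix (Fin t) (Fin t) K) : IsBrauerEquiv K A A' := by
  let d := Module.finrank K A'
  have hd : 0 < d := Module.finrank_pos
  have htpos : 0 < t := by
    rcases Nat.eq_zero_or_pos t with h | h
    · have h1 : 0 < Module.finrank K A := Module.finrank_pos
      have : 0 < Module.finrank K A * d := by positivity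
      subst h
      simp [d] at ht this; omega
    · exact h
  let T := Matrix (Fin t) (Fin t) A'
  let gA : A →ₐ[K] T := (AlgHom.mapMatrix (Algebra.ofId K A')).comp
    (ψ.comp Algebra.TensorProduct.includeLeft)
  let gop : A'ᵐᵒᵖ →ₐ[K] T := (AlgHom.mapMatrix (Algebra.ofId K A')).comp
    (ψ.comp Algebra.TensorProduct.includeRight)
  let gA' : A' →ₐ[K] T := Matrix.scalarAlgHom (Fin t) K
  have hAop : ∀ x y, Commute (gA x) (gop y) := fun x y ↦ by
    have h : Commute (x ⊗ₜ[K] (1 : A'ᵐᵒᵖ)) ((1 : A) ⊗ₜ[K] y) := by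
      simp [Commute, SemiconjBy]
    exact (h.map ψ).map (AlgHom.mapMatrix (Algebra.ofId K A'))
  have hg : ∀ x y, Commute (gA' x) (gop y) := fun x y ↦ (commute_mapMatrix_scalar _ _).symm
  let F : A ⊗[K] (A' ⊗[K] A'ᵐᵒᵖ) →ₐ[K] T :=
    Algebra.TensorProduct.lift gA (Algebra.TensorProduct.lift gA' gop hg) fun x y ↦
      commute_lift gA' gop hg _ (fun y ↦ commute_mapMatrix_scalar _ _) (hAop x) y
  let e : A' ⊗[K] A'ᵐᵒᵖ ≃ₐ[K] Matrix (Fin d) (Fin d) K :=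
    (AlgEquiv.ofBijective (AlgHom.mulLeftRight K A') (mulLeftRight_bijective A')).trans
      (algEquivMatrix (Module.finBasis K A'))
  let e' : Matrix (Fin d) (Fin d) A ≃ₐ[K] A ⊗[K] (A' ⊗[K] A'ᵐᵒᵖ) :=
    (matrixEquivTensor (Fin d) K A).trans (Algebra.TensorProduct.congr AlgEquiv.refl e.symm)
  have : Nonempty (Fin d) := ⟨⟨0, hd⟩⟩
  have : Nonempty (Fin t) := ⟨⟨0, htpos⟩⟩
  refine ⟨d, t, hd, htpos, ⟨AlgEquiv.ofBijective (F.comp e'.toAlgHom)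
    (bijective_of_finrank_eq _ ?_)⟩⟩
  simp only [Module.finrank_matrix, Fintype.card_fin]
  rw [← sq t, ht]
  ring


end General
end CentralSimple

namespace CentralSimple

section General

variable {K : Type} [Field K]

/-- The algebra `C` of dimension `t ^ 2` over `K` maps to the `t × t` matrices over `L`. -/
def SplitBy (K L C : Type) [Field K] [Field L] [Algebra K L] [Ring C] [Algebra K C] : Prop :=
  ∃ t, t ^ 2 = Module.finrank K C ∧ Nonempty (C →ₐ[K] Matrix (Fin t) (Fin t) L)

theorem SplitBy.map {L E C : Type} [Field L] [Algebra K L] [Field E] [Algebra K E] [Ring C]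
    [Algebra K C] (f : L →ₐ[K] E) (h : SplitBy K L C) : SplitBy K E C := by
  obtain ⟨t, ht, ⟨g⟩⟩ := h
  exact ⟨t, ht, ⟨f.mapMatrix.comp g⟩⟩

theorem exists_action {L E C : Type} [Field L] [Algebra K L] [Field E] [Algebra K E]
    [Algebra L E] [IsScalarTower K L E] [FiniteDimensional L E] [Ring C] [Algebra K C] {t : ℕ}
    (f : C →ₐ[K] Matrix (Fin t) (Fin t) E) :
    Nonempty (L ⊗[K] C →ₐ[L] Module.End L (Fin t × Fin (Module.finrank L E) → L)) := by
  let g₁ : E →ₐ[K] Matrix (Fin (Module.finrank L E)) (Fin (Module.finrank L E)) L :=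
    (Algebra.leftMulMatrix (Module.finBasis L E)).restrictScalars K
  let g₂ : C →ₐ[K] Module.End L (Fin t × Fin (Module.finrank L E) → L) :=
    (((Matrix.toLinAlgEquiv' (R := L)).toAlgHom.restrictScalars K).comp
      (Matrix.compAlgEquiv (Fin t) (Fin (Module.finrank L E)) L K).toAlgHom).comp
      (g₁.mapMatrix.comp f)
  exact ⟨Algebra.TensorProduct.lift (Algebra.ofId L _) g₂ fun x y ↦ Algebra.commutes x _⟩

/-- An algebra that is split by two extensions of `L` whose degrees are coprime is already split
by `L`. -/
theorem SplitBy.of_coprime {L E₁ E₂ C : Type} [Field L] [Algebra K L] [Field E₁] [Algebra K E₁]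
    [Algebra L E₁] [IsScalarTower K L E₁] [FiniteDimensional L E₁] [Field E₂] [Algebra K E₂]
    [Algebra L E₂] [IsScalarTower K L E₂] [FiniteDimensional L E₂] [Ring C] [Algebra K C]
    [FiniteDimensional K C] [IsSimpleRing C] [Algebra.IsCentral K C]
    (hd : (Module.finrank L E₁).Coprime (Module.finrank L E₂))
    (h₁ : SplitBy K E₁ C) (h₂ : SplitBy K E₂ C) : SplitBy K L C := by
  obtain ⟨t, ht, ⟨f₁⟩⟩ := h₁
  obtain ⟨t', ht', ⟨f₂⟩⟩ := h₂
  obtain rfl : t = t' := Nat.pow_left_injective (n := 2) (by norm_num) (ht.trans ht'.symm)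
  obtain ⟨g₁⟩ := exists_action (L := L) f₁
  obtain ⟨g₂⟩ := exists_action (L := L) f₂
  have : IsSimpleRing (L ⊗[K] C) := isSimpleRing_tensor L C
  obtain ⟨g⟩ := split_of_coprime g₁ g₂ (t := t) (by rw [Module.finrank_baseChange, ht])
    (by simp) (by simp) hd
  exact ⟨t, ht, ⟨(g.restrictScalars K).comp Algebra.TensorProduct.includeRight⟩⟩

/-- Brauer equivalence of base changes, in terms of splitting. -/
theorem isBrauerEquiv_baseChange_iff (L : Type) [Field L] [Algebra K L] (B D : Type) [Ring B]
    [Algebra K B] [FiniteDimensional K B] [IsSimpleRing B] [Algebra.IsCentral K B] [Ring D]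
    [Algebra K D] [FiniteDimensional K D] [IsSimpleRing D] [Algebra.IsCentral K D] :
    IsBrauerEquiv L (L ⊗[K] B) (L ⊗[K] D) ↔ SplitBy K L (B ⊗[K] Dᵐᵒᵖ) := by
  have hfin : Module.finrank K (B ⊗[K] Dᵐᵒᵖ) =
      Module.finrank L (L ⊗[K] B) * Module.finrank L (L ⊗[K] D) := by
    rw [Module.finrank_tensorProduct, Module.finrank_baseChange, Module.finrank_baseChange,
      (MulOpposite.opLinearEquiv K (M := D)).finrank_eq]
  constructor
  · intro h
    obtain ⟨t, ht, ⟨ψ⟩⟩ := exists_split_of_isBrauerEquiv h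
    refine ⟨t, ht.trans hfin.symm, ⟨?_⟩⟩
    let gB : B →ₐ[K] Matrix (Fin t) (Fin t) L :=
      (((ψ.comp Algebra.TensorProduct.includeLeft).restrictScalars K).comp
        (Algebra.TensorProduct.includeRight : B →ₐ[K] L ⊗[K] B))
    let gD : Dᵐᵒᵖ →ₐ[K] Matrix (Fin t) (Fin t) L :=
      (((ψ.comp Algebra.TensorProduct.includeRight).restrictScalars K).comp
        (AlgHom.op (Algebra.TensorProduct.includeRight : D →ₐ[K] L ⊗[K] D)))
    refine Algebra.TensorProduct.lift gB gD fun x y ↦ ?_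
    have h (x : L ⊗[K] B) (y : (L ⊗[K] D)ᵐᵒᵖ) :
        Commute (x ⊗ₜ[L] (1 : (L ⊗[K] D)ᵐᵒᵖ)) ((1 : L ⊗[K] B) ⊗ₜ[L] y) := by
      simp [Commute, SemiconjBy]
    exact (h _ _).map ψ
  · rintro ⟨t, ht, ⟨χ⟩⟩
    have : IsSimpleRing (L ⊗[K] B) := isSimpleRing_tensor L B
    have : IsSimpleRing (L ⊗[K] D) := isSimpleRing_tensor L D
    have : Algebra.IsCentral L (L ⊗[K] D) := center_baseChange L D
    let gB : L ⊗[K] B →ₐ[L] Matrix (Fin t) (Fin t) L :=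
      Algebra.TensorProduct.lift (Algebra.ofId L _) (χ.comp Algebra.TensorProduct.includeLeft)
        fun x y ↦ Algebra.commutes x _
    let gD₀ : L ⊗[K] D →ₐ[L] (Matrix (Fin t) (Fin t) L)ᵐᵒᵖ :=
      Algebra.TensorProduct.lift (Algebra.ofId L _)
        (AlgHom.opComm.symm (χ.comp Algebra.TensorProduct.includeRight))
        fun x y ↦ Algebra.commutes x _
    let gD : (L ⊗[K] D)ᵐᵒᵖ →ₐ[L] Matrix (Fin t) (Fin t) L := AlgHom.opComm gD₀
    have hcomm : ∀ x y, Commute (χ (x ⊗ₜ 1)) (χ (1 ⊗ₜ y)) := fun x y ↦ by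
      have h : Commute (x ⊗ₜ[K] (1 : Dᵐᵒᵖ)) ((1 : B) ⊗ₜ[K] y) := by simp [Commute, SemiconjBy]
      exact h.map χ
    have h₁ : ∀ (x : B) (y : L ⊗[K] D), Commute (χ (x ⊗ₜ 1)) (gD₀ y).unop := by
      intro x y
      induction y using TensorProduct.induction_on with
      | zero => simp
      | add y z hy hz => rw [map_add, MulOpposite.unop_add]; exact hy.add_right hz
      | tmul a d =>
        have : (gD₀ (a ⊗ₜ d)).unop = χ (1 ⊗ₜ MulOpposite.op d) * algebraMap L _ a := rfl
        rw [this]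
        exact (hcomm _ _).mul_right (Algebra.commutes a _).symm
    have h₂ : ∀ x y, Commute (gB x) (gD y) := by
      intro x y
      induction x using TensorProduct.induction_on with
      | zero => simp
      | add x z hx hz => rw [map_add]; exact hx.add_left hz
      | tmul a b =>
        have : gB (a ⊗ₜ b) = algebraMap L _ a * χ (b ⊗ₜ 1) := rfl
        rw [this]
        exact Commute.mul_left (Algebra.commutes a _) (h₁ b y.unop)
    exact isBrauerEquiv_of_split (ht.trans hfin) (Algebra.TensorProduct.lift gB gD h₂)

end General
end CentralSimple

namespace CentralSimple

theorem finrank_adjoin_dvd {K F : Type} [Field K] [Field F] [Algebra K F] {n : ℕ} (hn : n.Prime)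
    {ζ : K} (hζ : IsPrimitiveRoot ζ n) {y : F} {a : K} (hy : y ^ n = algebraMap K F a) :
    Module.finrank K (IntermediateField.adjoin K {y}) ∣ n := by
  by_cases hr : y ∈ (algebraMap K F).range
  · have : IntermediateField.adjoin K {y} = ⊥ := by
      rw [IntermediateField.adjoin_simple_eq_bot_iff, IntermediateField.mem_bot]
      exact hr
    rw [this, IntermediateField.finrank_bot]
    exact one_dvd n
  · have hirr : Irreducible (Polynomial.X ^ n - Polynomial.C a) := by
      apply X_pow_sub_C_irreducible_of_prime hn
      intro b hb
      apply hr
      have : NeZero n := ⟨hn.ne_zero⟩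
      rcases eq_or_ne b 0 with rfl | hb0
      · rw [zero_pow hn.ne_zero] at hb
        rw [← hb, map_zero] at hy
        rw [eq_zero_of_pow_eq_zero hy]
        exact zero_mem _
      · have h1 : (y / algebraMap K F b) ^ n = 1 := by
          rw [div_pow, hy, ← map_pow, hb, div_self]
          rw [← hb]; simp [hb0]
        obtain ⟨i, -, hi⟩ :=
          (hζ.map_of_injective (algebraMap K F).injective).eq_pow_of_pow_eq_one h1
        refine ⟨ζ ^ i * b, ?_⟩
        rw [map_mul, map_pow, hi, div_mul_cancel₀]
        simpa using hb0
    have hmonic : (Polynomial.X ^ n - Polynomial.C a).Monic :=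
      Polynomial.monic_X_pow_sub_C a hn.ne_zero
    have hev : Polynomial.aeval y (Polynomial.X ^ n - Polynomial.C a) = 0 := by simp [hy]
    have hxint : IsIntegral K y := ⟨_, hmonic, hev⟩
    rw [IntermediateField.adjoin.finrank hxint,
      ← minpoly.eq_of_irreducible_of_monic hirr hev hmonic, Polynomial.natDegree_X_pow_sub_C]

open IntermediateField in
theorem splitBy_of_conj {ω x c : ℂ} (hω : IsPrimitiveRoot ω 3)
    (hx : starRingEnd ℂ x ^ 2 ∈ adjoin ℚ {ω}) (hc : starRingEnd ℂ c ^ 3 ∈ adjoin ℚ {ω})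
    {C : Type} [Ring C] [Algebra ℚ C] [FiniteDimensional ℚ C] [IsSimpleRing C]
    [Algebra.IsCentral ℚ C] (h : SplitBy ℚ (adjoin ℚ {ω, x, starRingEnd ℂ c}) C) :
    SplitBy ℚ (adjoin ℚ {ω, x, c}) C := by
  let σ : ℂ →ₐ[ℚ] ℂ := (Complex.conjAe.toAlgHom).restrictScalars ℚ
  set L : IntermediateField ℚ ℂ := adjoin ℚ {ω, x, c} with hL
  have hLω : ω ∈ L := subset_adjoin _ _ (by simp)
  have hLx : x ∈ L := subset_adjoin _ _ (by simp)
  have hLc : c ∈ L := subset_adjoin _ _ (by simp)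
  have hLle : adjoin ℚ {ω} ≤ L := adjoin_le_iff.2 (by simpa using hLω)
  have hσω : σ ω = ω ^ 2 := by
    have h3 := hω.pow_eq_one
    have h0 : ω ≠ 0 := hω.ne_zero (by norm_num)
    have : ω⁻¹ = σ ω := Complex.inv_eq_conj (hω.norm'_eq_one (by norm_num))
    rw [← this]
    field_simp
    rw [← h3]
  have hω' : IsPrimitiveRoot (⟨ω, hLω⟩ : L) 3 :=
    IsPrimitiveRoot.coe_submonoidClass_iff.1 hω
  have hm1 : IsPrimitiveRoot (-1 : L) 2 := IsPrimitiveRoot.neg_one 0 (by norm_num)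
  let E₁ : IntermediateField L ℂ := adjoin L {σ c}
  let E₂ : IntermediateField L ℂ := adjoin L {σ x}
  have d₁ : Module.finrank L E₁ ∣ 3 :=
    finrank_adjoin_dvd Nat.prime_three hω' (a := ⟨_, hLle hc⟩) rfl
  have d₂ : Module.finrank L E₂ ∣ 2 :=
    finrank_adjoin_dvd Nat.prime_two hm1 (a := ⟨_, hLle hx⟩) rfl
  have : FiniteDimensional L E₁ :=
    FiniteDimensional.of_finrank_pos (Nat.pos_of_dvd_of_pos d₁ (by norm_num))
  have : FiniteDimensional L E₂ :=
    FiniteDimensional.of_finrank_pos (Nat.pos_of_dvd_of_pos d₂ (by norm_num))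
  have : IsScalarTower ℚ L E₁ := IsScalarTower.of_algebraMap_eq' (Subsingleton.elim _ _)
  have : IsScalarTower ℚ L E₂ := IsScalarTower.of_algebraMap_eq' (Subsingleton.elim _ _)
  have hE₁ : ∀ z ∈ L, z ∈ E₁ := fun z hz ↦ E₁.algebraMap_mem ⟨z, hz⟩
  have hE₂ : ∀ z ∈ L, z ∈ E₂ := fun z hz ↦ E₂.algebraMap_mem ⟨z, hz⟩
  have h₁ : adjoin ℚ {ω, x, σ c} ≤ E₁.restrictScalars ℚ := by
    rw [adjoin_le_iff]
    rintro z (rfl | rfl | rfl)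
    · exact hE₁ _ hLω
    · exact hE₁ _ hLx
    · exact subset_adjoin L {σ c} rfl
  have h₂ : adjoin ℚ {ω, x, σ c} ≤ (E₂.restrictScalars ℚ).comap σ := by
    rw [adjoin_le_iff]
    rintro z (rfl | rfl | rfl)
    · change σ z ∈ E₂
      rw [hσω]
      exact hE₂ _ (pow_mem hLω 2)
    · exact subset_adjoin L {σ z} rfl
    · change σ (σ c) ∈ E₂
      have : σ (σ c) = c := Complex.conj_conj c
      rw [this]
      exact hE₂ _ hLc
  have k₁ : SplitBy ℚ E₁ C := h.map (E := E₁) (inclusion h₁)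
  have k₂ : SplitBy ℚ E₂ C := h.map (E := E₂)
    ((σ.comp (adjoin ℚ {ω, x, σ c}).val).codRestrict (E₂.restrictScalars ℚ).toSubalgebra
      (fun z ↦ h₂ z.2))
  exact SplitBy.of_coprime
    (Nat.Coprime.coprime_dvd_left d₁ (Nat.Coprime.coprime_dvd_right d₂ (by norm_num))) k₁ k₂

end CentralSimple

namespace CentralSimple

section Padic

variable {r : ℕ} [Fact r.Prime]

theorem toZMod_eq_zero_iff (z : ℤ_[r]) : PadicInt.toZMod z = 0 ↔ ‖z‖ < 1 := by
  rw [← RingHom.mem_ker, PadicInt.ker_toZMod, IsLocalRing.mem_maximalIdeal, PadicInt.mem_nonunits]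

theorem toZMod_ne_zero_iff (z : ℤ_[r]) : PadicInt.toZMod z ≠ 0 ↔ ‖z‖ = 1 := by
  rw [Ne, toZMod_eq_zero_iff, not_lt]
  exact ⟨fun h ↦ le_antisymm z.norm_le_one h, fun h ↦ h.ge⟩

/-- Simple roots of `X ^ n - u` modulo `r` lift to the `r`-adic integers. -/
theorem exists_pow_eq {n : ℕ} (hn : ¬ r ∣ n) (u y₀ : ℤ_[r])
    (h : PadicInt.toZMod y₀ ^ n = PadicInt.toZMod u) (h0 : PadicInt.toZMod y₀ ≠ 0) :
    ∃ y : ℤ_[r], y ^ n = u ∧ PadicInt.toZMod y = PadicInt.toZMod y₀ := by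
  have hd : ‖(Polynomial.aeval y₀) (Polynomial.X ^ n - Polynomial.C u).derivative‖ = 1 := by
    rw [← toZMod_ne_zero_iff]
    have : (n : ZMod r) ≠ 0 := by rwa [Ne, ZMod.natCast_eq_zero_iff]
    rw [Polynomial.derivative_sub, Polynomial.derivative_X_pow, Polynomial.derivative_C]
    simp [this, h0]
  have hv : ‖(Polynomial.aeval y₀) (Polynomial.X ^ n - Polynomial.C u)‖ < 1 := by
    rw [← toZMod_eq_zero_iff]
    simp [h]
  obtain ⟨y, hy, hy', -⟩ := hensels_lemma (F := Polynomial.X ^ n - Polynomial.C u) (a := y₀)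
    (by rw [hd, one_pow]; exact hv)
  refine ⟨y, ?_, ?_⟩
  · simpa [sub_eq_zero] using hy
  · rw [hd, ← toZMod_eq_zero_iff, map_sub, sub_eq_zero] at hy'
    exact hy'

theorem toZMod_of_pow_eq {n : ℕ} (hn : n ≠ 0) {u : ℤ_[r]} {y : ℚ_[r]} (h : y ^ n = u) :
    ∃ z : ℤ_[r], (z : ℚ_[r]) = y ∧ PadicInt.toZMod z ^ n = PadicInt.toZMod u := by
  have h1 : ‖y‖ ≤ 1 := by
    have : ‖y‖ ^ n ≤ 1 := by rw [← norm_pow, h]; exact u.norm_le_one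
    exact (pow_le_one_iff_of_nonneg (norm_nonneg _) hn).1 this
  obtain ⟨z, hz⟩ : ∃ z : ℤ_[r], (z : ℚ_[r]) = y := ⟨⟨y, h1⟩, rfl⟩
  refine ⟨z, hz, ?_⟩
  rw [← map_pow]
  congr 1
  apply PadicInt.ext
  rw [PadicInt.coe_pow, hz, h]

end Padic

theorem isIntegral_generators {ω x c : ℂ} (hω : IsPrimitiveRoot ω 3) {a b : ℤ} {k : ℕ}
    (hx : x ^ 2 = a + b * ω) (hc : c ^ 3 = a + b * ω ^ k) :
    ∀ s ∈ ({ω, x, c} : Set ℂ), IsIntegral ℚ s := by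
  have h1 : IsIntegral ℚ ω := by
    refine IsIntegral.of_pow (n := 3) (by norm_num) ?_
    rw [hω.pow_eq_one]; exact isIntegral_one
  rintro s (rfl | rfl | rfl)
  · exact h1
  · refine IsIntegral.of_pow (n := 2) (by norm_num) ?_
    rw [hx]
    exact (isIntegral_algebraMap (x := (a : ℚ))).add
      ((isIntegral_algebraMap (x := (b : ℚ))).mul h1)
  · refine IsIntegral.of_pow (n := 3) (by norm_num) ?_
    rw [hc]
    exact (isIntegral_algebraMap (x := (a : ℚ))).add
      ((isIntegral_algebraMap (x := (b : ℚ))).mul (h1.pow k))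

open IntermediateField in
/-- Embedding `ℚ(ω, x, c)` into a field containing analogous elements. -/
theorem nonempty_ringHom {F : Type} [Field F] [CharZero F] {ω x c : ℂ} {ω' x' c' : F}
    (hω : IsPrimitiveRoot ω 3) (hω' : IsPrimitiveRoot ω' 3) {a b : ℤ} {k : ℕ}
    (hx : x ^ 2 = a + b * ω) (hc : c ^ 3 = a + b * ω ^ k)
    (hx' : x' ^ 2 = a + b * ω') (hc' : c' ^ 3 = a + b * ω' ^ k) :
    Nonempty (adjoin ℚ {ω, x, c} →+* F) := by
  let i : F →+* AlgebraicClosure F := algebraMap F (AlgebraicClosure F)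
  have iω : IsPrimitiveRoot (i ω') 3 := hω'.map_of_injective i.injective
  have hxint := isIntegral_generators hω hx hc
  have hmin : minpoly ℚ ω = Polynomial.cyclotomic 3 ℚ :=
    (Polynomial.cyclotomic_eq_minpoly_rat hω (by norm_num)).symm
  obtain ⟨φ, hφ⟩ := exists_algHom_adjoin_of_splits_of_aeval (F := ℚ) (K := AlgebraicClosure F)
    (S := {ω, x, c}) (fun s hs ↦ ⟨hxint s hs, IsAlgClosed.splits _⟩)
    (x := ω) (y := i ω') (subset_adjoin _ _ (by simp)) (by
      rw [hmin, Polynomial.aeval_def, ← Polynomial.eval_map, Polynomial.map_cyclotomic]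
      exact iω.isRoot_cyclotomic (by norm_num))
  let L := adjoin ℚ {ω, x, c}
  let ωL : L := ⟨ω, subset_adjoin _ _ (by simp)⟩
  let xL : L := ⟨x, subset_adjoin _ _ (by simp)⟩
  let cL : L := ⟨c, subset_adjoin _ _ (by simp)⟩
  have hφ' : φ ωL = i ω' := hφ
  have hφx : φ xL ^ 2 = i x' ^ 2 := by
    have : xL ^ 2 = a + b * ωL := by ext; simpa [xL, ωL] using hx
    rw [← map_pow, this, ← map_pow, hx']
    simp only [map_add, map_mul, map_intCast, hφ']
  have hφc : φ cL ^ 3 = i c' ^ 3 := by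
    have : cL ^ 3 = a + b * ωL ^ k := by ext; simpa [cL, ωL] using hc
    rw [← map_pow, this, ← map_pow, hc']
    simp only [map_add, map_mul, map_pow, map_intCast, hφ']
  have hx_mem : φ xL ∈ i.fieldRange := by
    rcases sq_eq_sq_iff_eq_or_eq_neg.1 hφx with h | h
    · exact ⟨x', h.symm⟩
    · exact ⟨-x', by rw [h, map_neg]⟩
  have hc_mem : φ cL ∈ i.fieldRange := by
    rcases eq_or_ne c' 0 with h0 | h0
    · rw [h0, map_zero, zero_pow (by norm_num)] at hφc
      rw [eq_zero_of_pow_eq_zero hφc]; exact zero_mem _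
    · have h0' : i c' ≠ 0 := by simpa using h0
      have h1 : (φ cL / i c') ^ 3 = 1 := by
        rw [div_pow, hφc, div_self (pow_ne_zero _ h0')]
      obtain ⟨j, -, hj⟩ := iω.eq_pow_of_pow_eq_one h1
      refine ⟨ω' ^ j * c', ?_⟩
      rw [map_mul, map_pow, hj, div_mul_cancel₀ _ h0']
  have hall : ∀ z : L, φ z ∈ i.fieldRange := by
    rintro ⟨z, hz⟩
    induction hz using adjoin_induction with
    | mem s hs =>
      rcases hs with rfl | rfl | rfl
      · exact ⟨ω', hφ.symm⟩
      · exact hx_mem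
      · exact hc_mem
    | algebraMap q =>
      have : φ (algebraMap ℚ L q) = i (q : F) := by simp
      exact ⟨_, this.symm⟩
    | add s t hs ht h1 h2 =>
      have := add_mem h1 h2
      rwa [← map_add] at this
    | inv s hs h1 =>
      have := inv_mem h1
      rwa [← map_inv₀] at this
    | mul s t hs ht h1 h2 =>
      have := mul_mem h1 h2
      rwa [← map_mul] at this
  let e : F ≃+* i.fieldRange := RingEquiv.ofBijective i.rangeRestrictField
    ⟨i.rangeRestrictField.injective, i.rangeRestrictField_bijective.2⟩
  exact ⟨e.symm.toRingHom.comp ((φ : L →+* _).codRestrict i.fieldRange hall)⟩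

theorem zmod_seven_aux : ∀ u v w : ZMod 7, w ^ 2 + w + 1 = 0 → u ^ 2 = -1 + 1 * w →
    v ^ 3 = -1 + 1 * w ^ 2 → False := by
  decide

theorem zmod_seven_two : (2 : ZMod 7) ^ 3 = 1 ∧ (2 : ZMod 7) ≠ 0 ∧ (2 : ZMod 7) ≠ 1 ∧
    -1 + (2 : ZMod 7) = 1 := by
  decide

theorem not_nonempty_ringHom_seven {ω x c : ℂ} (hω : IsPrimitiveRoot ω 3) {a b : ℤ}
    (ha : (a : ZMod 7) = -1) (hb : (b : ZMod 7) = 1) (hx : x ^ 2 = a + b * ω)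
    (hc : c ^ 3 = a + b * ω ^ 2) [Fact (Nat.Prime 7)] :
    IsEmpty (IntermediateField.adjoin ℚ {ω, x, c} →+* ℚ_[7]) := by
  constructor
  intro φ
  let L := IntermediateField.adjoin ℚ {ω, x, c}
  let ωL : L := ⟨ω, IntermediateField.subset_adjoin _ _ (by simp)⟩
  let xL : L := ⟨x, IntermediateField.subset_adjoin _ _ (by simp)⟩
  let cL : L := ⟨c, IntermediateField.subset_adjoin _ _ (by simp)⟩
  have hωL : IsPrimitiveRoot ωL 3 := IsPrimitiveRoot.coe_submonoidClass_iff.1 hω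
  have hxL : φ xL ^ 2 = a + b * φ ωL := by
    have : xL ^ 2 = a + b * ωL := by ext; simpa [xL, ωL] using hx
    rw [← map_pow, this]; simp
  have hcL : φ cL ^ 3 = a + b * φ ωL ^ 2 := by
    have : cL ^ 3 = a + b * ωL ^ 2 := by ext; simpa [cL, ωL] using hc
    rw [← map_pow, this, map_add, map_mul, map_pow, map_intCast, map_intCast]
  have h1 : φ ωL ^ 2 + φ ωL + 1 = 0 := by
    have h := (hωL.map_of_injective φ.injective).isRoot_cyclotomic (by norm_num)
    rw [Polynomial.cyclotomic_three] at h
    simpa using h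
  have h3 : φ ωL ^ 3 = ((1 : ℤ_[7]) : ℚ_[7]) := by
    rw [← map_pow, hωL.pow_eq_one, map_one]; rfl
  obtain ⟨w, hw, -⟩ := toZMod_of_pow_eq (by norm_num) h3
  have hw1 : w ^ 2 + w + 1 = 0 := by
    apply PadicInt.ext
    rw [← hw] at h1
    exact_mod_cast h1
  rw [← hw] at hxL hcL
  obtain ⟨u, -, hu⟩ := toZMod_of_pow_eq (u := (a : ℤ_[7]) + (b : ℤ_[7]) * w) (by norm_num)
    (hxL.trans (by push_cast; rfl))
  obtain ⟨v, -, hv⟩ := toZMod_of_pow_eq (u := (a : ℤ_[7]) + (b : ℤ_[7]) * w ^ 2) (by norm_num)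
    (hcL.trans (by push_cast; rfl))
  have hw2 := congrArg PadicInt.toZMod hw1
  simp only [map_add, map_mul, map_pow, map_intCast, ha, hb, map_one, map_zero] at hu hv hw2
  generalize PadicInt.toZMod u = u' at *
  generalize PadicInt.toZMod v = v' at *
  generalize PadicInt.toZMod w = w' at *
  exact zmod_seven_aux u' v' w' hw2 hu hv

theorem exists_primitiveRoot_padic {r : ℕ} [Fact r.Prime] (hr : r % 3 = 1) (hr3 : r ≠ 3) :
    ∃ w : ℤ_[r], IsPrimitiveRoot (w : ℚ_[r]) 3 := by
  obtain ⟨g, hg⟩ : ∃ g : (ZMod r)ˣ, orderOf g = 3 := by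
    have : Fact (Nat.Prime 3) := ⟨Nat.prime_three⟩
    apply exists_prime_orderOf_dvd_card
    rw [ZMod.card_units_eq_totient, Nat.totient_prime Fact.out]
    omega
  obtain ⟨y₀, hy₀⟩ := ZMod.ringHom_surjective (PadicInt.toZMod (p := r)) (g : ZMod r)
  have hpow : (g : ZMod r) ^ 3 = 1 := by
    have := pow_orderOf_eq_one g
    rw [hg] at this
    rw [← Units.val_pow_eq_pow_val, this, Units.val_one]
  obtain ⟨y, hy, hy'⟩ := exists_pow_eq (n := 3)
    (fun h ↦ hr3 ((Nat.prime_dvd_prime_iff_eq Fact.out Nat.prime_three).1 h)) 1 y₀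
    (by rw [hy₀, hpow, map_one]) (by rw [hy₀]; exact g.ne_zero)
  refine ⟨y, ?_⟩
  have hy1 : (y : ℚ_[r]) ≠ 1 := by
    intro h
    have : y = 1 := PadicInt.ext h
    rw [this, map_one, hy₀] at hy'
    have : g = 1 := Units.ext hy'.symm
    rw [this, orderOf_one] at hg
    norm_num at hg
  have h3 : (y : ℚ_[r]) ^ 3 = 1 := by rw [← PadicInt.coe_pow, hy]; rfl
  have := orderOf_eq_prime h3 hy1
  exact this ▸ IsPrimitiveRoot.orderOf _

theorem exists_sqrt_neg_three {ω : ℂ} (hω : IsPrimitiveRoot ω 3) (L : IntermediateField ℚ ℂ)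
    (hL : ω ∈ L) : ∃ s : L, s ^ 2 = -3 := by
  have hωL : IsPrimitiveRoot (⟨ω, hL⟩ : L) 3 := IsPrimitiveRoot.coe_submonoidClass_iff.1 hω
  have h := hωL.isRoot_cyclotomic (by norm_num)
  generalize (⟨ω, hL⟩ : L) = w at h
  rw [Polynomial.cyclotomic_three] at h
  have h : w ^ 2 + w + 1 = 0 := by simpa using h
  exact ⟨1 + 2 * w, by linear_combination 4 * h⟩

open IntermediateField in
/-- Two non-isomorphic number fields that are indistinguishable by splitting of central simple
`ℚ`-algebras and embed into `ℚ_[r]`. -/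
theorem exists_fields (r : ℕ) [Fact r.Prime] (hr : r % 3 = 1) (hr7 : 7 < r) :
    ∃ L₁ L₂ : IntermediateField ℚ ℂ, FiniteDimensional ℚ L₁ ∧ FiniteDimensional ℚ L₂ ∧
      IsEmpty (L₁ ≃+* L₂) ∧ Nonempty (L₁ →+* ℚ_[r]) ∧ Nonempty (L₂ →+* ℚ_[r]) ∧
      (∃ s : L₁, s ^ 2 = -3) ∧
      ∀ (C : Type) [Ring C] [Algebra ℚ C] [FiniteDimensional ℚ C] [IsSimpleRing C]
        [Algebra.IsCentral ℚ C], SplitBy ℚ L₁ C ↔ SplitBy ℚ L₂ C := by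
  have h7 : Fact (Nat.Prime 7) := ⟨by norm_num⟩
  have hcop : IsCoprime (r : ℤ) 7 := by
    have : Nat.Coprime r 7 := (Nat.coprime_primes Fact.out (by norm_num)).2 hr7.ne'
    exact_mod_cast this.isCoprime
  obtain ⟨u, v, huv⟩ := hcop
  -- `b ≡ 0 mod r`, `b ≡ 1 mod 7`
  let b : ℤ := u * r
  let a : ℤ := 1 - 2 * b
  have hbr : (b : ZMod r) = 0 := by simp [b]
  have har : (a : ZMod r) = 1 := by simp [a, hbr]
  have hb7 : (b : ZMod 7) = 1 := by
    have : b = 1 - v * 7 := by simp only [b]; linarith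
    rw [this]
    push_cast
    have : (7 : ZMod 7) = 0 := rfl
    rw [this]; simp
  have ha7 : (a : ZMod 7) = -1 := by simp [a, hb7]; rfl
  let ω : ℂ := Complex.exp (2 * Real.pi * Complex.I / (3 : ℕ))
  have hω : IsPrimitiveRoot ω 3 := Complex.isPrimitiveRoot_exp 3 (by norm_num)
  have hconj : starRingEnd ℂ ω = ω ^ 2 := by
    have h3 := hω.pow_eq_one
    have h0 : ω ≠ 0 := hω.ne_zero (by norm_num)
    rw [← Complex.inv_eq_conj (hω.norm'_eq_one (by norm_num))]
    field_simp
    rw [← h3]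
  obtain ⟨x, hx⟩ := IsAlgClosed.exists_pow_nat_eq ((a : ℂ) + b * ω) (n := 2) (by norm_num)
  obtain ⟨c, hc⟩ := IsAlgClosed.exists_pow_nat_eq ((a : ℂ) + b * ω) (n := 3) (by norm_num)
  have hc₁ : starRingEnd ℂ c ^ 3 = a + b * ω ^ 2 := by
    rw [← map_pow, hc]; simp [hconj]
  have hx₁ : starRingEnd ℂ x ^ 2 = a + b * ω ^ 2 := by
    rw [← map_pow, hx]; simp [hconj]
  have hωmem : ω ∈ adjoin ℚ {ω} := subset_adjoin _ _ rfl
  have hmem : ∀ k, (a + b * ω ^ k : ℂ) ∈ adjoin ℚ {ω} := fun k ↦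
    add_mem (intCast_mem _ _) (mul_mem (intCast_mem _ _) (pow_mem hωmem k))
  have h2 : PadicInt.toZMod (2 : ℤ_[7]) = 2 := map_ofNat _ 2
  obtain ⟨h2_cube, h2_ne, h2_ne', h2_add⟩ := zmod_seven_two
  obtain ⟨ω₇, hω₇, hω₇'⟩ : ∃ w : ℤ_[7], IsPrimitiveRoot (w : ℚ_[7]) 3 ∧
      PadicInt.toZMod w = 2 := by
    obtain ⟨y, hy, hy'⟩ := exists_pow_eq (r := 7) (n := 3) (by norm_num) 1 2
      (by rw [h2, map_one, h2_cube]) (by rwa [h2])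
    have hy1 : (y : ℚ_[7]) ≠ 1 := by
      intro h
      have : y = 1 := PadicInt.ext h
      rw [this, map_one, h2] at hy'
      exact h2_ne' hy'.symm
    have h3 : (y : ℚ_[7]) ^ 3 = 1 := by rw [← PadicInt.coe_pow, hy]; rfl
    exact ⟨y, orderOf_eq_prime h3 hy1 ▸ IsPrimitiveRoot.orderOf _, by rw [hy', h2]⟩
  obtain ⟨ω', hω'⟩ := exists_primitiveRoot_padic hr (by omega)
  have hroot : ∀ n k, ¬ r ∣ n → ∃ y : ℚ_[r], y ^ n = a + b * (ω' : ℚ_[r]) ^ k := by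
    intro n k hn
    obtain ⟨y, hy, -⟩ :=
      exists_pow_eq hn ((a : ℤ_[r]) + (b : ℤ_[r]) * ω' ^ k) 1 (by simp [har, hbr])
      (by simp)
    exact ⟨y, by rw [← PadicInt.coe_pow, hy]; push_cast; rfl⟩
  have hroot₇ : ∀ n, ¬ 7 ∣ n → ∃ y : ℚ_[7], y ^ n = a + b * (ω₇ : ℚ_[7]) ^ 1 := by
    intro n hn
    obtain ⟨y, hy, -⟩ := exists_pow_eq hn ((a : ℤ_[7]) + (b : ℤ_[7]) * ω₇ ^ 1) 1
      (by simp [ha7, hb7, hω₇', h2_add]) (by simp)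
    exact ⟨y, by rw [← PadicInt.coe_pow, hy]; push_cast; rfl⟩
  have hr2 : ¬ r ∣ 2 := fun h ↦ by have := Nat.le_of_dvd (by norm_num) h; omega
  have hr3 : ¬ r ∣ 3 := fun h ↦ by have := Nat.le_of_dvd (by norm_num) h; omega
  obtain ⟨x', hx'⟩ := hroot 2 1 hr2
  have hemb : ∀ k c, c ^ 3 = a + b * ω ^ k → Nonempty (adjoin ℚ {ω, x, c} →+* ℚ_[r]) := by
    intro k c hc
    obtain ⟨c', hc'⟩ := hroot 3 k hr3
    exact nonempty_ringHom hω hω' hx hc (by rw [hx', pow_one]) hc'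
  have hemb₇ : Nonempty (adjoin ℚ {ω, x, c} →+* ℚ_[7]) := by
    obtain ⟨x'', hx''⟩ := hroot₇ 2 (by norm_num)
    obtain ⟨c'', hc''⟩ := hroot₇ 3 (by norm_num)
    exact nonempty_ringHom (k := 1) hω hω₇ hx (by rw [hc, pow_one]) (by rw [hx'', pow_one]) hc''
  refine ⟨adjoin ℚ {ω, x, starRingEnd ℂ c}, adjoin ℚ {ω, x, c},
    finiteDimensional_adjoin (isIntegral_generators hω hx hc₁),
    finiteDimensional_adjoin (isIntegral_generators hω hx (k := 1) (by rw [hc, pow_one])),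
    ⟨fun e ↦ ?_⟩, hemb 2 _ hc₁, hemb 1 _ (by rw [hc, pow_one]),
    exists_sqrt_neg_three hω _ (subset_adjoin _ _ (by simp)),
    fun C _ _ _ _ _ ↦ ⟨fun h ↦ ?_, fun h ↦ ?_⟩⟩
  · obtain ⟨f⟩ := hemb₇
    exact (not_nonempty_ringHom_seven hω ha7 hb7 hx hc₁).false (f.comp e.toRingHom)
  · exact splitBy_of_conj hω (by rw [hx₁]; exact hmem 2) (by rw [hc₁]; exact hmem 2) h
  · refine splitBy_of_conj hω (by rw [hx₁]; exact hmem 2) ?_ ?_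
    · rw [Complex.conj_conj, hc]; simpa using hmem 1
    · rwa [Complex.conj_conj]

end CentralSimple

namespace CentralSimple

section Cyclic

/-- The carry factor `u ^ p = r` of the cyclic algebra. -/
def carry (p r : ℕ) (a : ZMod p) : ℕ := if a = -1 then r else 1

theorem natCast_ne_neg_one {p n : ℕ} (hn : n + 1 < p) : (n : ZMod p) ≠ -1 := by
  intro h
  have : ((n + 1 : ℕ) : ZMod p) = 0 := by push_cast; rw [h]; ring
  rw [ZMod.natCast_eq_zero_iff] at this
  exact absurd (Nat.le_of_dvd (by omega) this) (by omega)

variable {p : ℕ} [NeZero p] (r : ℕ) {k R : Type} [CommRing k] [CommRing R] [Algebra k R]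
  (σ : R ≃ₐ[k] R)

/-- The cyclic algebra `⨁ R u ^ i` with `u x = σ x u` and `u ^ p = r`, realised by the matrices of
its right multiplications. -/
def cyclicAlgebra (p : ℕ) [NeZero p] (r : ℕ) {k R : Type} [CommRing k] [CommRing R] [Algebra k R]
    (σ : R ≃ₐ[k] R) : Subalgebra k (Matrix (ZMod p) (ZMod p) R) where
  carrier := {M | ∀ a b, (carry p r a : R) * M (a + 1) (b + 1) = carry p r b * σ (M a b)}
  mul_mem' := by
    intro M N hM hN a b
    rw [Matrix.mul_apply, Matrix.mul_apply, ← Equiv.sum_comp (Equiv.addRight (1 : ZMod p)),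
      Finset.mul_sum, map_sum, Finset.mul_sum]
    refine Finset.sum_congr rfl fun e _ ↦ ?_
    have h1 := hM a e
    have h2 := hN e b
    rw [Equiv.coe_addRight, map_mul]
    linear_combination N (e + 1) (b + 1) * h1 + σ (M a e) * h2
  add_mem' := by
    intro M N hM hN a b
    have h1 := hM a b
    have h2 := hN a b
    rw [Matrix.add_apply, Matrix.add_apply, map_add]
    linear_combination h1 + h2
  algebraMap_mem' := by
    intro q a b
    rw [Matrix.algebraMap_matrix_apply, Matrix.algebraMap_matrix_apply]
    by_cases h : a = b
    · subst h; simp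
    · simp [h]

variable {r σ}

theorem cyclicAlgebra_apply {M : Matrix (ZMod p) (ZMod p) R} (hM : M ∈ cyclicAlgebra p r σ)
    {n : ℕ} (hn : n < p) (b : ZMod p) :
    M n (b + n) = (if p ≤ b.val + n then (r : R) else 1) * (σ ^ n) (M 0 b) := by
  induction n with
  | zero => simp [Nat.not_le.2 (ZMod.val_lt b)]
  | succ n ih =>
    have h := hM n (b + n)
    rw [carry, if_neg (natCast_ne_neg_one hn), ih (by omega)] at h
    have hb := ZMod.val_lt b
    have key : b + n = -1 ↔ b.val + n + 1 = p := by
      rw [eq_neg_iff_add_eq_zero]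
      have : b + n + 1 = ((b.val + n + 1 : ℕ) : ZMod p) := by simp
      rw [this, ZMod.natCast_eq_zero_iff]
      constructor
      · rintro ⟨t, ht⟩
        rcases t with _ | _ | t
        · omega
        · omega
        · have : p * (t + 1 + 1) = p * t + p + p := by ring
          omega
      · intro h; rw [h]
    have e1 : ((n + 1 : ℕ) : ZMod p) = n + 1 := by push_cast; rfl
    rw [e1, ← add_assoc]
    rw [Nat.cast_one, one_mul] at h
    rw [h, carry, map_mul, pow_succ', AlgEquiv.mul_apply, ← mul_assoc]
    congr 1
    by_cases h1 : b.val + n + 1 = p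
    · rw [if_pos (key.2 h1), if_neg (by omega), if_pos (by omega), map_one, mul_one]
    · rw [if_neg (fun h ↦ h1 (key.1 h))]
      by_cases h2 : p ≤ b.val + n
      · rw [if_pos h2, if_pos (by omega)]; simp
      · rw [if_neg h2, if_neg (by omega)]; simp

theorem cyclicAlgebra_ext {M N : cyclicAlgebra p r σ} (h : ∀ b, M.1 0 b = N.1 0 b) : M = N := by
  refine Subtype.ext (Matrix.ext fun a b ↦ ?_)
  have h1 := cyclicAlgebra_apply M.2 (ZMod.val_lt a) (b - a)
  have h2 := cyclicAlgebra_apply N.2 (ZMod.val_lt a) (b - a)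
  rw [h] at h1
  rw [← h2] at h1
  simpa using h1

/-- The generator `u`. -/
def cyclicGen (p : ℕ) [NeZero p] (r : ℕ) {k R : Type} [CommRing k] [CommRing R] [Algebra k R]
    (σ : R ≃ₐ[k] R) : cyclicAlgebra p r σ :=
  ⟨Matrix.of fun a b ↦ if b = a + 1 then (carry p r a : R) else 0, fun a b ↦ by
    by_cases h : b = a + 1
    · subst h; simp [mul_comm]
    · simp [h]⟩

/-- The embedding of the maximal subfield. -/
def cyclicDiag (hσ : σ ^ p = 1) (x : R) : cyclicAlgebra p r σ :=
  ⟨Matrix.diagonal fun a ↦ (σ ^ a.val) x, fun a b ↦ by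
    by_cases h : a = b
    · subst h
      rw [Matrix.diagonal_apply_eq, Matrix.diagonal_apply_eq, ← AlgEquiv.mul_apply, ← pow_succ']
      congr 2
      have : (a + 1).val ≡ a.val + 1 [MOD orderOf σ] := by
        refine Nat.ModEq.of_dvd (orderOf_dvd_of_pow_eq_one hσ) ?_
        rw [← ZMod.natCast_eq_natCast_iff]; simp
      exact pow_eq_pow_iff_modEq.2 this ▸ rfl
    · rw [Matrix.diagonal_apply_ne _ h, Matrix.diagonal_apply_ne _ (by simpa using h)]
      simp⟩

theorem mul_cyclicGen_apply (M : cyclicAlgebra p r σ) (a b : ZMod p) :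
    (M * cyclicGen p r σ).1 a (b + 1) = M.1 a b * carry p r b := by
  simp [cyclicGen, Matrix.mul_apply]

theorem cyclicGen_mul_apply (M : cyclicAlgebra p r σ) (a b : ZMod p) :
    (cyclicGen p r σ * M).1 a b = carry p r a * M.1 (a + 1) b := by
  simp [cyclicGen, Matrix.mul_apply]

theorem cyclicGen_pow_apply {n : ℕ} (hn : n < p) (b : ZMod p) :
    (cyclicGen p r σ ^ n).1 0 b = if b = n then 1 else 0 := by
  induction n generalizing b with
  | zero => simp [Matrix.one_apply, eq_comm]
  | succ n ih =>
    obtain ⟨b, rfl⟩ : ∃ c, b = c + 1 := ⟨b - 1, by simp⟩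
    rw [pow_succ, mul_cyclicGen_apply, ih (by omega)]
    by_cases h : b = n
    · subst h; simp [carry, natCast_ne_neg_one hn]
    · simp [h]

theorem cyclicDiag_mul_apply (hσ : σ ^ p = 1) (x : R) (M : cyclicAlgebra p r σ) (b : ZMod p) :
    (cyclicDiag hσ x * M).1 0 b = x * M.1 0 b := by
  simp [cyclicDiag]

theorem mul_cyclicDiag_apply (hσ : σ ^ p = 1) (x : R) (M : cyclicAlgebra p r σ) (b : ZMod p) :
    (M * cyclicDiag hσ x).1 0 b = M.1 0 b * (σ ^ b.val) x := by
  simp [cyclicDiag]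

/-- Elements of the cyclic algebra are determined by their coordinates `∑ x_i u ^ i`. -/
noncomputable def cyclicCoord (r : ℕ) (hσ : σ ^ p = 1) :
    cyclicAlgebra p r σ ≃ₗ[k] (ZMod p → R) :=
  LinearEquiv.ofBijective
    { toFun := fun M b ↦ M.1 0 b
      map_add' := fun _ _ ↦ rfl
      map_smul' := fun _ _ ↦ rfl } <| by
    refine ⟨fun M N h ↦ cyclicAlgebra_ext fun b ↦ congrFun h b, fun x ↦
      ⟨∑ i : ZMod p, cyclicDiag hσ (x i) * cyclicGen p r σ ^ i.val, ?_⟩⟩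
    ext b
    have : ∀ M : cyclicAlgebra p r σ, ({ toFun := fun M b ↦ M.1 0 b
                                         map_add' := fun _ _ ↦ rfl
                                         map_smul' := fun _ _ ↦ rfl } :
      cyclicAlgebra p r σ →ₗ[k] (ZMod p → R)) M b = M.1 0 b := fun _ ↦ rfl
    rw [map_sum, Finset.sum_apply]
    simp only [this, cyclicDiag_mul_apply, cyclicGen_pow_apply (ZMod.val_lt _)]
    simp

theorem finrank_cyclicAlgebra {K : Type} [Field K] [Algebra ℚ K] {σ : K ≃ₐ[ℚ] K}
    [FiniteDimensional ℚ K] (hσ : σ ^ p = 1) (hK : Module.finrank ℚ K = p) :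
    Module.finrank ℚ (cyclicAlgebra p r σ) = p ^ 2 := by
  rw [(cyclicCoord r hσ).finrank_eq, Module.finrank_pi_fintype]
  simp [hK, ZMod.card, sq]

theorem isCentral_cyclicAlgebra {K : Type} [Field K] [Algebra ℚ K] {σ : K ≃ₐ[ℚ] K}
    (hp : 1 < p) (hσ : σ ^ p = 1) (hσ' : ∀ n, 0 < n → n < p → σ ^ n ≠ 1)
    (hfix : ∀ x, σ x = x → ∃ q : ℚ, algebraMap ℚ K q = x) :
    Algebra.IsCentral ℚ (cyclicAlgebra p r σ) := by
  constructor
  intro z hz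
  rw [Subalgebra.mem_center_iff] at hz
  have h0 : ∀ b, b ≠ 0 → z.1 0 b = 0 := by
    intro b hb
    have hne := hσ' b.val (by rw [Nat.pos_iff_ne_zero]; simpa using hb) (ZMod.val_lt b)
    obtain ⟨x, hx⟩ : ∃ x, (σ ^ b.val) x ≠ x := by
      by_contra! h
      exact hne (AlgEquiv.ext h)
    have h1 := congrArg (fun M ↦ M.1 0 b) (hz (cyclicDiag hσ x))
    simp only [cyclicDiag_mul_apply, mul_cyclicDiag_apply] at h1
    have h2 : z.1 0 b * ((σ ^ b.val) x - x) = 0 := by linear_combination -h1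
    exact (mul_eq_zero.1 h2).resolve_right (sub_ne_zero.2 hx)
  have h1 := congrArg (fun M ↦ M.1 0 (0 + 1)) (hz (cyclicGen p r σ))
  simp only [mul_cyclicGen_apply, cyclicGen_mul_apply] at h1
  have hc : carry p r (0 : ZMod p) = 1 := by
    have := natCast_ne_neg_one (p := p) (n := 0) (by omega)
    rw [carry, if_neg (by simpa using this)]
  rw [z.2 0 0, hc] at h1
  obtain ⟨q, hq⟩ := hfix (z.1 0 0) (by simpa using h1)
  refine Algebra.mem_bot.2 ⟨q, cyclicAlgebra_ext fun b ↦ ?_⟩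
  change (algebraMap ℚ (Matrix (ZMod p) (ZMod p) K) q) 0 b = _
  rw [Matrix.algebraMap_matrix_apply]
  by_cases h : (0 : ZMod p) = b
  · subst h; simpa using hq
  · rw [if_neg h, h0 b (Ne.symm h)]

/-- Leading coefficients: the product of two elements of the order that are nonzero modulo `r` is
nonzero modulo `r ^ 2`. -/
theorem not_sq_dvd_mul [IsDomain R] (hr : Prime (r : R)) (M N : cyclicAlgebra p r σ)
    (hM : ∃ b, ¬ (r : R) ∣ M.1 0 b) (hN : ∃ b, ¬ (r : R) ∣ N.1 0 b) :
    ∃ b, ¬ (r : R) ^ 2 ∣ (M * N).1 0 b := by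
  have lift : ∀ M : cyclicAlgebra p r σ, (∃ b, ¬ (r : R) ∣ M.1 0 b) → ∃ i < p,
      ¬ (r : R) ∣ M.1 0 (i : ZMod p) ∧ ∀ j < i, (r : R) ∣ M.1 0 (j : ZMod p) := by
    classical
    rintro M ⟨b, hb⟩
    have hex : ∃ i : ℕ, ¬ (r : R) ∣ M.1 0 (i : ZMod p) := ⟨b.val, by simpa using hb⟩
    refine ⟨Nat.find hex, (Nat.find_min' hex (m := b.val) (by simpa using hb)).trans_lt
      (ZMod.val_lt b), Nat.find_spec hex, fun j hj ↦ not_not.1 (Nat.find_min hex hj)⟩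
  obtain ⟨i, hip, hi, hi'⟩ := lift M hM
  obtain ⟨j, hjp, hj, hj'⟩ := lift N hN
  have hσr : ∀ (n : ℕ) (x : R), (r : R) ∣ x → (r : R) ∣ (σ ^ n) x := by
    rintro n _ ⟨y, rfl⟩
    exact ⟨(σ ^ n) y, by rw [map_mul, map_natCast]⟩
  have hσr' : ∀ (n : ℕ) (x : R), (r : R) ∣ (σ ^ n) x → (r : R) ∣ x := by
    rintro n x ⟨y, hy⟩
    exact ⟨(σ ^ n).symm y, (σ ^ n).injective (by
      rw [hy, map_mul, map_natCast, AlgEquiv.apply_symm_apply])⟩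
  have hij : ¬ (r : R) ∣ M.1 0 (i : ZMod p) * (σ ^ i) (N.1 0 (j : ZMod p)) := fun h ↦
    (hr.dvd_or_dvd h).elim hi fun h ↦ hj (hσr' _ _ h)
  refine ⟨(j : ZMod p) + i, fun h ↦ ?_⟩
  have hsum : (M * N).1 0 ((j : ZMod p) + i) =
      ∑ a : ZMod p, M.1 0 a * N.1 a ((j : ZMod p) + i) := by
    simp [Matrix.mul_apply]
  rw [hsum, ← Finset.add_sum_erase _ _ (Finset.mem_univ (i : ZMod p)),
    cyclicAlgebra_apply N.2 hip, ZMod.val_natCast_of_lt hjp] at h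
  -- the coefficient attached to `a ≠ i`
  have hterm : ∀ a : ZMod p, a ≠ i → ∃ n : ℕ, n < p ∧ a.val ≠ i ∧
      (n : ℤ) + a.val ≡ j + i [ZMOD p] ∧ N.1 a ((j : ZMod p) + i) =
      (if p ≤ n + a.val then (r : R) else 1) * (σ ^ a.val) (N.1 0 (n : ZMod p)) := by
    intro a ha
    refine ⟨((j : ZMod p) + i - a).val, ZMod.val_lt _, fun h ↦ ha (by rw [← h]; simp), ?_, ?_⟩
    · rw [← ZMod.intCast_eq_intCast_iff]; simp
    · have := cyclicAlgebra_apply N.2 (ZMod.val_lt a) ((j : ZMod p) + i - a)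
      simpa using this
  have hcases : ∀ a : ZMod p, a ≠ i → ∃ n : ℕ, n < p ∧ a.val ≠ i ∧
      (n + a.val = j + i ∨ n + a.val = j + i + p ∨ n + a.val + p = j + i) ∧
      N.1 a ((j : ZMod p) + i) =
      (if p ≤ n + a.val then (r : R) else 1) * (σ ^ a.val) (N.1 0 (n : ZMod p)) := by
    intro a ha
    obtain ⟨n, hn, hai, hmod, h⟩ := hterm a ha
    refine ⟨n, hn, hai, ?_, h⟩
    obtain ⟨t, ht⟩ := hmod.dvd
    have hav := ZMod.val_lt a
    have hp0 : (0 : ℤ) < p := by omega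
    have h1 : t < 2 := by nlinarith
    have h2 : -2 < t := by nlinarith
    have h3 : t = -1 ∨ t = 0 ∨ t = 1 := by omega
    rcases h3 with rfl | rfl | rfl <;> omega
  rcases lt_or_ge (j + i) p with hlt | hge
  · rw [if_neg (by omega), one_mul] at h
    refine hij ((dvd_add_left (Finset.dvd_sum fun a ha ↦ ?_)).1
      ((dvd_pow_self _ two_ne_zero).trans h))
    obtain ⟨n, hn, hai, hs, hN⟩ := hcases a (Finset.ne_of_mem_erase ha)
    rw [hN]
    by_cases hc : p ≤ n + a.val
    · rw [if_pos hc]; exact (dvd_mul_right _ _).mul_left _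
    · rcases lt_or_ge a.val i with h1 | h1
      · have := hi' _ h1
        rw [ZMod.natCast_val, ZMod.cast_id] at this
        exact this.mul_right _
      · exact ((hσr _ _ (hj' n (by omega))).mul_left _).mul_left _
  · rw [if_pos hge] at h
    have h' : (r : R) ^ 2 ∣ r * (M.1 0 (i : ZMod p) * (σ ^ i) (N.1 0 (j : ZMod p))) := by
      rw [mul_left_comm]
      refine (dvd_add_left (Finset.dvd_sum fun a ha ↦ ?_)).1 h
      obtain ⟨n, hn, hai, hs, hN⟩ := hcases a (Finset.ne_of_mem_erase ha)
      have hav := ZMod.val_lt a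
      rw [hN, sq]
      have hMa : a.val < i → (r : R) ∣ M.1 0 a := fun h1 ↦ by
        have := hi' _ h1
        rwa [ZMod.natCast_val, ZMod.cast_id] at this
      by_cases hc : p ≤ n + a.val
      · rw [if_pos hc]
        rcases lt_or_ge a.val i with h1 | h1
        · exact mul_dvd_mul (hMa h1) (dvd_mul_right _ _)
        · exact (mul_dvd_mul_left _ (hσr _ _ (hj' n (by omega)))).mul_left _
      · rw [if_neg hc, one_mul]
        exact mul_dvd_mul (hMa (by omega)) (hσr _ _ (hj' n (by omega)))
    rw [sq] at h'
    exact hij ((mul_dvd_mul_iff_left hr.ne_zero).1 h')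

end Cyclic

end CentralSimple

namespace CentralSimple

section Domain

variable {r : ℕ} [hr : Fact r.Prime] {ι : Type} [Fintype ι]

theorem exists_primitive (z : ι → ℚ_[r]) (hz : z ≠ 0) :
    ∃ (t : ℚ_[r]) (Z : ι → ℤ_[r]), (∀ i, (Z i : ℚ_[r]) = t * z i) ∧ ∃ i, Z i = 1 := by
  obtain ⟨i₁, hi₁⟩ := Function.ne_iff.1 hz
  obtain ⟨i₀, -, hmax⟩ := Finset.exists_max_image Finset.univ (fun i ↦ ‖z i‖) ⟨i₁, by simp⟩
  have h0 : 0 < ‖z i₀‖ := (norm_pos_iff.2 hi₁).trans_le (hmax i₁ (by simp))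
  have h0' : z i₀ ≠ 0 := norm_pos_iff.1 h0
  refine ⟨(z i₀)⁻¹, fun i ↦ ⟨(z i₀)⁻¹ * z i, ?_⟩, fun i ↦ rfl, i₀, ?_⟩
  · rw [norm_mul, norm_inv, inv_mul_le_iff₀ h0, mul_one]
    exact hmax i (by simp)
  · exact PadicInt.ext (inv_mul_cancel₀ h0')

/-- Nonvanishing of a bilinear product over `ℚ_[r]` from its reduction modulo `r ^ 2`. -/
theorem eq_zero_or_eq_zero_of_padic (c : ι → ι → ι → ℤ)
    (hc : ∀ X Y : ι → ℤ, (∃ i, ¬ (r : ℤ) ∣ X i) → (∃ i, ¬ (r : ℤ) ∣ Y i) →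
      ∃ l, ¬ (r : ℤ) ^ 2 ∣ ∑ i, ∑ j, X i * Y j * c i j l) (z w : ι → ℚ_[r])
    (h : ∀ l, ∑ i, ∑ j, z i * w j * c i j l = 0) : z = 0 ∨ w = 0 := by
  by_contra! hzw
  obtain ⟨s, Z, hZ, i₀, hi₀⟩ := exists_primitive z hzw.1
  obtain ⟨t, W, hW, j₀, hj₀⟩ := exists_primitive w hzw.2
  have hr2 : Fact (1 < r ^ 2) := ⟨Nat.one_lt_pow two_ne_zero hr.out.one_lt⟩
  have hnd : ∀ (U : ι → ℤ_[r]) (i : ι), U i = 1 →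
      ∃ i, ¬ (r : ℤ) ∣ ((PadicInt.toZModPow 2 (U i)).val : ℤ) := by
    intro U i hi
    refine ⟨i, ?_⟩
    rw [hi, map_one, ZMod.val_one, Int.natCast_dvd_natCast]
    exact hr.out.one_lt.ne' ∘ Nat.dvd_one.1
  obtain ⟨l, hl⟩ := hc (fun i ↦ (PadicInt.toZModPow 2 (Z i)).val)
    (fun i ↦ (PadicInt.toZModPow 2 (W i)).val) (hnd Z i₀ hi₀) (hnd W j₀ hj₀)
  apply hl
  have hsum : ∑ i, ∑ j, Z i * W j * (c i j l : ℤ_[r]) = 0 := by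
    refine (injective_iff_map_eq_zero (PadicInt.Coe.ringHom (p := r))).1
      (fun x y h ↦ PadicInt.ext h) _ ?_
    have : s * t * ∑ i, ∑ j, z i * w j * c i j l = 0 := by rw [h, mul_zero]
    have hZ' : ∀ i, PadicInt.Coe.ringHom (Z i) = s * z i := hZ
    have hW' : ∀ i, PadicInt.Coe.ringHom (W i) = t * w i := hW
    simp only [map_sum, map_mul, hZ', hW', map_intCast]
    rw [← this, Finset.mul_sum]
    refine Finset.sum_congr rfl fun i _ ↦ ?_
    rw [Finset.mul_sum]
    exact Finset.sum_congr rfl fun j _ ↦ by ring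
  have := congrArg (PadicInt.toZModPow (p := r) 2) hsum
  simp only [map_sum, map_mul, map_intCast, map_zero] at this
  have hcast : ((r : ℤ) ^ 2) = ((r ^ 2 : ℕ) : ℤ) := by push_cast; rfl
  rw [hcast, ← ZMod.intCast_zmod_eq_zero_iff_dvd]
  push_cast
  simpa using this

variable {Λ D : Type} [Ring Λ] [Ring D] [Algebra ℚ D]

theorem noZeroDivisors_baseChange [DecidableEq ι] (f : Λ →+* D) (b : Module.Basis ι ℤ Λ)
    (B : Module.Basis ι ℚ D) (hB : ∀ i, B i = f (b i))
    (hS : ∀ x y : Λ, (∃ i, ¬ (r : ℤ) ∣ b.repr x i) → (∃ i, ¬ (r : ℤ) ∣ b.repr y i) →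
      ∃ i, ¬ (r : ℤ) ^ 2 ∣ b.repr (x * y) i)
    (F : Type) [Field F] [Algebra ℚ F] (φ : F →+* ℚ_[r]) : NoZeroDivisors (F ⊗[ℚ] D) := by
  let c : ι → ι → ι → ℤ := fun i j l ↦ b.repr (b i * b j) l
  have hBmul : ∀ i j, B i * B j = ∑ l, (c i j l : ℚ) • B l := by
    intro i j
    rw [hB, hB, ← map_mul, ← b.sum_repr (b i * b j), map_sum]
    refine Finset.sum_congr rfl fun l _ ↦ ?_
    rw [map_zsmul, hB, Int.cast_smul_eq_zsmul]
  let BF := Algebra.TensorProduct.basis F B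
  have hBF : ∀ i j, BF i * BF j = ∑ l, (c i j l : F) • BF l := by
    intro i j
    simp only [BF, Algebra.TensorProduct.basis_apply, Algebra.TensorProduct.tmul_mul_tmul, hBmul,
      one_mul, TensorProduct.tmul_sum]
    refine Finset.sum_congr rfl fun l _ ↦ ?_
    rw [TensorProduct.tmul_smul, Int.cast_smul_eq_zsmul, Int.cast_smul_eq_zsmul]
  have hmul : ∀ z w l, BF.repr (z * w) l = ∑ i, ∑ j, BF.repr z i * BF.repr w j * c i j l := by
    intro z w l
    conv_lhs => rw [← BF.sum_repr z, ← BF.sum_repr w]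
    simp only [Finset.sum_mul, Finset.mul_sum, smul_mul_smul_comm, hBF, map_sum, map_smul,
      Finsupp.finsetSum_apply, Finsupp.smul_apply, smul_eq_mul, Module.Basis.repr_self]
    rw [Finset.sum_comm]
    refine Finset.sum_congr rfl fun i _ ↦ Finset.sum_congr rfl fun j _ ↦ ?_
    rw [Finset.sum_eq_single l]
    · simp
    · intro m _ hm; simp [hm]
    · simp
  refine ⟨fun {z w} hzw ↦ ?_⟩
  have key := eq_zero_or_eq_zero_of_padic c ?_ (fun i ↦ φ (BF.repr z i))
    (fun i ↦ φ (BF.repr w i)) ?_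
  · have h0 : ∀ z : F ⊗[ℚ] D, (fun i ↦ φ (BF.repr z i)) = 0 → z = 0 := by
      intro z h
      refine BF.ext_elem fun i ↦ φ.injective ?_
      simpa using congrFun h i
    exact key.imp (h0 z) (h0 w)
  · intro X Y hX hY
    have hrepr : ∀ X : ι → ℤ, ∀ i, b.repr (∑ i, X i • b i) i = X i := fun X i ↦
      congrFun (b.repr_sum_self X) i
    obtain ⟨l, hl⟩ := hS (∑ i, X i • b i) (∑ i, Y i • b i) (by simpa only [hrepr] using hX)
      (by simpa only [hrepr] using hY)
    refine ⟨l, fun h ↦ hl ?_⟩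
    convert h
    simp only [Finset.sum_mul, Finset.mul_sum, smul_mul_smul_comm, map_sum, map_smul,
      Finsupp.finsetSum_apply, Finsupp.smul_apply, smul_eq_mul]
    rw [Finset.sum_comm]
  · intro l
    have := congrArg φ (hmul z w l)
    rw [hzw] at this
    simpa using this.symm

end Domain

section NumberField

open NumberField

variable {K : Type} [Field K] [NumberField K]

theorem natCast_dvd_iff_repr {M : Type} [Ring M] {κ : Type} [Fintype κ] (b : Module.Basis κ ℤ M)
    (n : ℕ) (x : M) : (n : M) ∣ x ↔ ∀ i, (n : ℤ) ∣ b.repr x i := by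
  constructor
  · rintro ⟨y, rfl⟩ i
    rw [← nsmul_eq_mul, map_nsmul]
    exact ⟨b.repr y i, by simp⟩
  · intro h
    choose y hy using h
    refine ⟨∑ i, y i • b i, ?_⟩
    rw [← b.sum_repr x, Finset.mul_sum]
    refine Finset.sum_congr rfl fun i _ ↦ ?_
    rw [hy, mul_smul, ← nsmul_eq_mul]
    simp

/-- The automorphism of the ring of integers induced by `σ`. -/
noncomputable def intAut (σ : K ≃ₐ[ℚ] K) : 𝓞 K ≃ₐ[ℤ] 𝓞 K :=
  (RingOfIntegers.mapRingEquiv σ.toRingEquiv).toIntAlgEquiv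

theorem coe_intAut (σ : K ≃ₐ[ℚ] K) (x : 𝓞 K) : ((intAut σ x : 𝓞 K) : K) = σ x := rfl

theorem algebraMap_intAut (σ : K ≃ₐ[ℚ] K) (x : 𝓞 K) :
    algebraMap (𝓞 K) K (intAut σ x) = σ (algebraMap (𝓞 K) K x) := rfl

theorem intAut_pow {σ : K ≃ₐ[ℚ] K} {p : ℕ} (hσ : σ ^ p = 1) : intAut σ ^ p = 1 := by
  have : ∀ (n : ℕ) (x : 𝓞 K), (((intAut σ ^ n) x : 𝓞 K) : K) = (σ ^ n) x := by
    intro n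
    induction n with
    | zero => intro x; rfl
    | succ n ih =>
      intro x
      rw [pow_succ, pow_succ, AlgEquiv.mul_apply, AlgEquiv.mul_apply, ih, coe_intAut]
  ext x
  rw [this, hσ]; rfl

/-- The inclusion of the integral order into the cyclic algebra. -/
noncomputable def orderHom (p : ℕ) [NeZero p] (r : ℕ) (σ : K ≃ₐ[ℚ] K) :
    cyclicAlgebra p r (intAut σ) →+* cyclicAlgebra p r σ :=
  ((algebraMap (𝓞 K) K).mapMatrix.comp (cyclicAlgebra p r (intAut σ)).val.toRingHom).codRestrict
    (cyclicAlgebra p r σ) fun M a b ↦ by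
      have := congrArg (algebraMap (𝓞 K) K) (M.2 a b)
      simpa [algebraMap_intAut] using this

theorem noZeroDivisors_cyclicAlgebra {p : ℕ} [NeZero p] {r : ℕ} [Fact r.Prime] {σ : K ≃ₐ[ℚ] K}
    (hσ : σ ^ p = 1) (hr : Prime (r : 𝓞 K)) (F : Type) [Field F] [Algebra ℚ F] (φ : F →+* ℚ_[r]) :
    NoZeroDivisors (F ⊗[ℚ] cyclicAlgebra p r σ) := by
  classical
  let b := (Pi.basis fun _ : ZMod p ↦ RingOfIntegers.basis K).map
    (cyclicCoord r (intAut_pow hσ)).symm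
  let B := (Pi.basis fun _ : ZMod p ↦ integralBasis K).map (cyclicCoord r hσ).symm
  have hrepr : ∀ x a i, b.repr x ⟨a, i⟩ = (RingOfIntegers.basis K).repr (x.1 0 a) i := by
    intro x a i
    simp only [b, Module.Basis.map_repr, LinearEquiv.trans_apply, Pi.basis_repr]
    rfl
  have hdvd : ∀ (n : ℕ) x, (∃ i, ¬ (n : ℤ) ∣ b.repr x i) ↔ ∃ a, ¬ (n : 𝓞 K) ∣ x.1 0 a := by
    intro n x
    simp only [Sigma.exists, hrepr, natCast_dvd_iff_repr (RingOfIntegers.basis K), not_forall]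
  refine noZeroDivisors_baseChange (r := r) (orderHom p r σ) b B ?_ ?_ F φ
  · rintro ⟨a, i⟩
    apply (cyclicCoord r hσ).injective
    ext d
    have h1 : cyclicCoord r hσ (orderHom p r σ (b ⟨a, i⟩)) d =
      algebraMap (𝓞 K) K (cyclicCoord r (intAut_pow hσ) (b ⟨a, i⟩) d) := rfl
    rw [h1]
    simp only [B, b, Module.Basis.map_apply, LinearEquiv.apply_symm_apply, Pi.basis_apply]
    by_cases h : d = a
    · subst h; simp
    · simp [h]
  · intro x y hx hy
    rw [hdvd] at hx hy
    have := not_sq_dvd_mul hr x y hx hy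
    rw [← Nat.cast_pow] at this ⊢
    exact (hdvd (r ^ 2) _).2 this

end NumberField

end CentralSimple

namespace CentralSimple

open NumberField

theorem prime_of_orderOf {N : Type} [Field N] [NumberField N] (l : ℕ) [Fact l.Prime]
    [IsCyclotomicExtension {l} ℚ N] (r : ℕ) [hr : Fact r.Prime] (hrl : ¬ r ∣ l)
    (hord : orderOf (r : ZMod l) = l - 1) : Prime (r : 𝓞 N) := by
  obtain ⟨⟨P, hP, hPo⟩⟩ := (Ideal.span {(r : ℤ)}).nonempty_primesOver (S := 𝓞 N)
  have hdeg := IsCyclotomicExtension.Rat.inertiaDeg_eq_of_not_dvd (m := l) r N P hrl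
  have hmax : (Ideal.span {(r : ℤ)}).IsMaximal := Int.ideal_span_isMaximal_of_prime r
  have hPmax : P.IsMaximal := Ideal.IsMaximal.of_liesOver_isMaximal P (Ideal.span {(r : ℤ)})
  have hnorm := Ideal.absNorm_eq_pow_inertiaDeg' P hr.out
  rw [Ideal.inertiaDeg'_eq_inertiaDeg, hdeg, hord] at hnorm
  have hn : Module.finrank ℤ (𝓞 N) = l - 1 := by
    rw [RingOfIntegers.rank, IsCyclotomicExtension.finrank (n := l) N
      (Polynomial.cyclotomic.irreducible_rat (Nat.Prime.pos Fact.out)),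
      Nat.totient_prime Fact.out]
  have hle : Ideal.span {(r : 𝓞 N)} ≤ P := by
    rw [Ideal.span_singleton_le_iff_mem]
    have : (r : ℤ) ∈ P.under ℤ := by
      rw [← hPo.over]; exact Ideal.mem_span_singleton_self _
    simpa [Ideal.mem_comap] using this
  obtain ⟨J, hJ⟩ := Ideal.dvd_iff_le.2 hle
  have h1 := congrArg Ideal.absNorm hJ
  rw [map_mul, Ideal.absNorm_span_natCast, hn, hnorm] at h1
  have h2 : Ideal.absNorm J = 1 :=
    Nat.eq_of_mul_eq_mul_left (pow_pos hr.out.pos (l - 1)) (by rw [← h1, mul_one])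
  rw [Ideal.absNorm_eq_one_iff] at h2
  rw [h2, Ideal.mul_top] at hJ
  rw [← Ideal.span_singleton_prime (by exact_mod_cast hr.out.ne_zero), hJ]
  exact hP

theorem prime_natCast_of_ringHom {K N : Type} [Field K] [Field N] [CharZero N] (f : K →+* N)
    {r : ℕ} (hr : Prime (r : 𝓞 N)) : Prime (r : 𝓞 K) := by
  have hr0 : r ≠ 0 := by rintro rfl; exact hr.ne_zero Nat.cast_zero
  have hrK : (r : K) ≠ 0 := by
    rw [← f.injective.ne_iff, map_natCast, map_zero]; exact_mod_cast hr0
  let F := RingOfIntegers.mapRingHom f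
  have hdvd : ∀ x : 𝓞 K, (r : 𝓞 N) ∣ F x → (r : 𝓞 K) ∣ x := by
    rintro x ⟨y, hy⟩
    have hy' : f x = r * y := by
      have := congrArg (algebraMap (𝓞 N) N) hy
      simpa [F] using this
    have hxint : IsIntegral ℤ ((x : K) / r) := by
      have h : f ((x : K) / r) = y := by
        rw [map_div₀, hy', map_natCast, mul_div_cancel_left₀]; exact_mod_cast hr0
      have h2 : IsIntegral ℤ (f.toIntAlgHom ((x : K) / r)) := by
        change IsIntegral ℤ (f ((x : K) / r))
        rw [h]; exact y.isIntegral_coe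
      exact (isIntegral_algHom_iff f.toIntAlgHom f.injective).1 h2
    obtain ⟨z, hz⟩ : ∃ z : 𝓞 K, algebraMap _ K z = algebraMap _ K x / r :=
      ⟨⟨_, hxint⟩, rfl⟩
    refine ⟨z, RingOfIntegers.coe_injective ?_⟩
    rw [map_mul, map_natCast, hz, mul_div_cancel₀ _ hrK]
  refine ⟨fun h ↦ hr.ne_zero ?_, fun h ↦ hr.not_isUnit ?_, fun x y h ↦ ?_⟩
  · have := congrArg F h
    simpa using this
  · have := h.map F
    simpa using this
  · have := map_dvd F h
    rw [map_natCast, map_mul] at this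
    exact (hr.dvd_or_dvd this).imp (hdvd x) (hdvd y)

/-- A cyclic extension of `ℚ` of degree `p` in which the prime `r` is inert. -/
structure InertCyclic (p r : ℕ) (K : Type) [Field K] [NumberField K] (σ : K ≃ₐ[ℚ] K) : Prop where
  finrank_eq : Module.finrank ℚ K = p
  pow_eq_one : σ ^ p = 1
  pow_ne_one : ∀ n, 0 < n → n < p → σ ^ n ≠ 1
  exists_rat : ∀ x, σ x = x → ∃ q : ℚ, algebraMap ℚ K q = x
  prime : Prime (r : 𝓞 K)

theorem exists_inertCyclic_of_isGalois {p r : ℕ} (hp : p.Prime) (K : Type) [Field K] [CharZero K]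
    [i : Algebra ℚ K] [FiniteDimensional ℚ K] [IsGalois ℚ K] (hK : Module.finrank ℚ K = p)
    (hr : Prime (r : 𝓞 K)) :
    ∃ (K : Type) (_ : Field K) (_ : NumberField K) (σ : K ≃ₐ[ℚ] K), InertCyclic p r K σ := by
  obtain rfl : i = DivisionRing.toRatAlgebra := Subsingleton.elim _ _
  have hN : NumberField K := ⟨⟩
  have : Fact p.Prime := ⟨hp⟩
  have hcard : Nat.card (K ≃ₐ[ℚ] K) = p := by rw [IsGalois.card_aut_eq_finrank, hK]
  have hcyc : IsCyclic (K ≃ₐ[ℚ] K) := isCyclic_of_prime_card hcard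
  obtain ⟨σ, hσ⟩ := hcyc.exists_generator
  have hord : orderOf σ = p := by rw [orderOf_eq_card_of_forall_mem_zpowers hσ, hcard]
  refine ⟨K, _, hN, σ, hK, hord ▸ pow_orderOf_eq_one σ, fun n hn hnp h ↦ ?_, fun x hx ↦ ?_, hr⟩
  · have := Nat.le_of_dvd hn (orderOf_dvd_of_pow_eq_one h)
    omega
  · have : x ∈ Set.range (algebraMap ℚ K) := by
      rw [IsGalois.mem_range_algebraMap_iff_fixed]
      intro τ
      have hle : Subgroup.zpowers σ ≤ MulAction.stabilizer (K ≃ₐ[ℚ] K) x := by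
        rw [Subgroup.zpowers_le]; exact hx
      exact hle (hσ τ)
    exact this

theorem exists_prime_mod (l : ℕ) [Fact l.Prime] (hl : 3 < l) (g : (ZMod l)ˣ) :
    ∃ r > max 7 l, r.Prime ∧ r % 3 = 1 ∧ (r : ZMod l) = g := by
  have hcop : Nat.Coprime 3 l := (Nat.coprime_primes Nat.prime_three Fact.out).2 hl.ne
  obtain ⟨a, ha3, hal⟩ := Nat.chineseRemainder hcop 1 (g : ZMod l).val
  have hal' : (a : ZMod l) = g := by
    rw [(ZMod.natCast_eq_natCast_iff _ _ _).2 hal]; simp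
  have hunit : IsUnit (a : ZMod (3 * l)) := by
    rw [ZMod.isUnit_iff_coprime]
    refine Nat.Coprime.mul_right ?_ ?_
    · rw [Nat.Coprime, ha3.gcd_eq]; simp
    · rw [← ZMod.isUnit_iff_coprime, hal']; exact g.isUnit
  have : NeZero (3 * l) := ⟨by omega⟩
  obtain ⟨r, hr, hrp, hra⟩ := Nat.forall_exists_prime_gt_and_eq_mod hunit (max 7 l)
  rw [ZMod.natCast_eq_natCast_iff] at hra
  refine ⟨r, hr, hrp, (hra.of_mul_right l).trans ha3, ?_⟩
  rw [← hal', ZMod.natCast_eq_natCast_iff]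
  exact hra.of_mul_left 3

theorem exists_inertCyclic_of_isCyclotomicExtension {p : ℕ} (hp : p.Prime) (l : ℕ)
    [hlp : Fact l.Prime] (hpl : p ∣ l - 1) (g : (ZMod l)ˣ) (hgord : orderOf g = l - 1)
    (N : Type) [Field N] [NumberField N] [IsCyclotomicExtension {l} ℚ N]
    (r : ℕ) (hrN : Prime (r : 𝓞 N)) :
    ∃ (K : Type) (_ : Field K) (_ : NumberField K) (σ : K ≃ₐ[ℚ] K), InertCyclic p r K σ := by
  have hgal : IsGalois ℚ N := IsCyclotomicExtension.isGalois {l} ℚ N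
  let e : (N ≃ₐ[ℚ] N) ≃* (ZMod l)ˣ := IsCyclotomicExtension.Rat.galEquivZMod l N
  have hcomm : ∀ a b : N ≃ₐ[ℚ] N, a * b = b * a := fun a b ↦
    e.injective (by rw [map_mul, map_mul, mul_comm])
  let τ := e.symm g
  have hτ : orderOf τ = l - 1 := by rw [← hgord]; exact e.symm.orderOf_eq g
  let H := Subgroup.zpowers (τ ^ p)
  have hnormal : H.Normal := ⟨fun a ha b ↦ by rwa [hcomm b a, mul_inv_cancel_right]⟩
  have hH : Nat.card H = (l - 1) / p := by
    rw [Nat.card_zpowers, orderOf_pow' _ hp.ne_zero, hτ, Nat.gcd_eq_right hpl]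
  have hfin : Module.finrank ℚ N = l - 1 := by
    rw [IsCyclotomicExtension.finrank (n := l) N
      (Polynomial.cyclotomic.irreducible_rat hlp.out.pos), Nat.totient_prime hlp.out]
  have hl1 : 0 < l - 1 := Nat.sub_pos_of_lt hlp.out.one_lt
  have hK : Module.finrank ℚ (IntermediateField.fixedField H) = p := by
    have h1 := Module.finrank_mul_finrank ℚ (IntermediateField.fixedField H) N
    rw [IntermediateField.finrank_fixedField_eq_card, hH, hfin] at h1
    have h2 := Nat.div_mul_cancel hpl
    have h3 : 0 < (l - 1) / p := Nat.div_pos (Nat.le_of_dvd hl1 hpl) hp.pos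
    refine Nat.eq_of_mul_eq_mul_right h3 ?_
    rw [h1, mul_comm, h2]
  have hgalK : IsGalois ℚ (IntermediateField.fixedField H) :=
    IsGalois.of_fixedField_normal_subgroup H
  exact exists_inertCyclic_of_isGalois hp (IntermediateField.fixedField H) hK
    (prime_natCast_of_ringHom (algebraMap _ N) hrN)

theorem exists_isCyclotomicExtension (l : ℕ) [NeZero l] :
    ∃ (N : Type) (_ : Field N) (_ : NumberField N), IsCyclotomicExtension {l} ℚ N := by
  refine ⟨CyclotomicField l ℚ, inferInstance, inferInstance, ?_⟩
  convert CyclotomicField.isCyclotomicExtension l ℚ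
  · rfl
  · exact Subsingleton.elim _ _

theorem exists_inertCyclic {p : ℕ} (hp : p.Prime) :
    ∃ r, r.Prime ∧ r % 3 = 1 ∧ 7 < r ∧
      ∃ (K : Type) (_ : Field K) (_ : NumberField K) (σ : K ≃ₐ[ℚ] K), InertCyclic p r K σ := by
  obtain ⟨l, hlp, hl3, hl⟩ := Nat.exists_prime_gt_modEq_one 3 hp.ne_zero
  have : Fact l.Prime := ⟨hlp⟩
  obtain ⟨g, hg⟩ := IsCyclic.exists_generator (α := (ZMod l)ˣ)
  have hgord : orderOf g = l - 1 := by
    rw [orderOf_eq_card_of_forall_mem_zpowers hg, Nat.card_eq_fintype_card,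
      ZMod.card_units_eq_totient, Nat.totient_prime hlp]
  obtain ⟨r, hr, hrp, hr3, hrg⟩ := exists_prime_mod l hl3 g
  have hrf : Fact r.Prime := ⟨hrp⟩
  obtain ⟨N, _, _, _⟩ := exists_isCyclotomicExtension l
  refine ⟨r, hrp, hr3, (le_max_left _ _).trans_lt hr, ?_⟩
  exact exists_inertCyclic_of_isCyclotomicExtension hp l
    ((Nat.modEq_iff_dvd' hlp.one_lt.le).1 hl.symm) g hgord N r (prime_of_orderOf l r
    (fun h ↦ ((le_max_right 7 l).trans_lt hr).ne' ((Nat.prime_dvd_prime_iff_eq hrp hlp).1 h))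
    (by rw [hrg, orderOf_units, hgord]))

end CentralSimple

namespace CentralSimple

variable {K : Type} [Field K]

theorem isUnit_of_noZeroDivisors {D : Type} [Ring D] [Nontrivial D] [NoZeroDivisors D] [Algebra K D]
    [FiniteDimensional K D] {x : D} (hx : x ≠ 0) : IsUnit x := by
  have hinj : Function.Injective (LinearMap.mulLeft K x) := by
    rw [← LinearMap.ker_eq_bot, LinearMap.ker_eq_bot']
    exact fun y hy ↦ (mul_eq_zero.1 hy).resolve_left hx
  obtain ⟨y, hy⟩ := LinearMap.injective_iff_surjective.1 hinj 1
  have hy' : x * y = 1 := hy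
  refine ⟨⟨x, y, hy', ?_⟩, rfl⟩
  have : x * (y * x - 1) = 0 := by rw [mul_sub, ← mul_assoc, hy', one_mul, mul_one, sub_self]
  exact sub_eq_zero.1 ((mul_eq_zero.1 this).resolve_left hx)

theorem isSimpleRing_of_isUnit {D : Type} [Ring D] [Nontrivial D]
    (h : ∀ x : D, x ≠ 0 → IsUnit x) : IsSimpleRing D := by
  refine ⟨⟨fun I ↦ ?_⟩⟩
  by_cases hI : ∃ x ∈ I, x ≠ 0
  · right
    obtain ⟨x, hxI, hx⟩ := hI
    obtain ⟨u, rfl⟩ := h x hx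
    have h1 : (1 : D) ∈ I := by simpa using I.mul_mem_left (↑u⁻¹) _ hxI
    rw [eq_top_iff]
    intro y _
    simpa using I.mul_mem_left y _ h1
  · left
    push Not at hI
    rw [eq_bot_iff]
    intro x hx
    rw [hI x hx]
    exact zero_mem _

/-- If `H` is a division algebra and `H ⊗ H'ᵐᵒᵖ` acts on a space of dimension `dim H`, then square
roots of scalars in `H'` give rise to square roots in `H`. -/
theorem exists_sq_of_action {H H' W : Type} [Ring H] [Algebra K H] [FiniteDimensional K H]
    [Nontrivial H] [Ring H'] [Algebra K H'] [AddCommGroup W] [Module K W] [FiniteDimensional K W]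
    (hH : ∀ x : H, x ≠ 0 → IsUnit x) (g : H ⊗[K] H'ᵐᵒᵖ →ₐ[K] Module.End K W)
    (hW : Module.finrank K W = Module.finrank K H) {y : H'} {t : K}
    (hy : y * y = algebraMap K H' t) : ∃ x : H, x * x = algebraMap K H t := by
  have hpos : 0 < Module.finrank K W := hW ▸ Module.finrank_pos
  obtain ⟨v, hv⟩ := Module.finrank_pos_iff_exists_ne_zero.1 hpos
  let l : H →ₐ[K] Module.End K W := g.comp Algebra.TensorProduct.includeLeft
  let r : H'ᵐᵒᵖ →ₐ[K] Module.End K W := g.comp Algebra.TensorProduct.includeRight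
  have hlr : ∀ x y, l x * r y = r y * l x := fun x y ↦ by
    simp [l, r, ← map_mul]
  let e : H →ₗ[K] W := (LinearMap.applyₗ v).comp l.toLinearMap
  have he : Function.Injective e := by
    rw [← LinearMap.ker_eq_bot, LinearMap.ker_eq_bot']
    intro x hx
    by_contra hx0
    obtain ⟨u, rfl⟩ := hH x hx0
    have hx' : l u v = 0 := hx
    apply hv
    calc v = l (↑u⁻¹ * u) v := by simp
      _ = 0 := by rw [map_mul, Module.End.mul_apply, hx', map_zero]
  have hsurj := (LinearMap.injective_iff_surjective_of_finrank_eq_finrank hW.symm).1 he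
  obtain ⟨x, hx⟩ := hsurj (r (MulOpposite.op y) v)
  have hx' : l x v = r (MulOpposite.op y) v := hx
  refine ⟨x, he ?_⟩
  change l (x * x) v = l (algebraMap K H t) v
  calc l (x * x) v = (l x * r (MulOpposite.op y)) v := by
        rw [map_mul, Module.End.mul_apply, hx', Module.End.mul_apply]
    _ = r (MulOpposite.op y * MulOpposite.op y) v := by
        rw [hlr, Module.End.mul_apply, hx', map_mul, Module.End.mul_apply]
    _ = l (algebraMap K H t) v := by
        rw [← MulOpposite.op_mul, hy, ← MulOpposite.algebraMap_apply, AlgHom.commutes,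
          AlgHom.commutes]

theorem exists_algEquiv_tensor_mop (D : Type) [Ring D] [Algebra K D] [FiniteDimensional K D]
    [IsSimpleRing D] [Algebra.IsCentral K D] :
    Nonempty (D ⊗[K] Dᵐᵒᵖ ≃ₐ[K]
      Matrix (Fin (Module.finrank K D)) (Fin (Module.finrank K D)) K) :=
  ⟨(AlgEquiv.ofBijective _ (mulLeftRight_bijective (K := K) D)).trans
    (algEquivMatrix (Module.finBasis K D))⟩

theorem exists_sq_of_isBrauerEquiv {D H H' : Type} [Ring D] [Algebra K D] [FiniteDimensional K D]
    [IsSimpleRing D] [Algebra.IsCentral K D] [Ring H] [Algebra K H] [FiniteDimensional K H]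
    [Nontrivial H] [Ring H'] [Algebra K H'] [FiniteDimensional K H']
    (hH : ∀ x : H, x ≠ 0 → IsUnit x) (hHH' : Module.finrank K H' = Module.finrank K H)
    (h : IsBrauerEquiv K (D ⊗[K] H) (D ⊗[K] H')) {y : H'} {t : K}
    (hy : y * y = algebraMap K H' t) : ∃ x : H, x * x = algebraMap K H t := by
  obtain ⟨s, hs, ⟨ψ⟩⟩ := exists_split_of_isBrauerEquiv h
  obtain ⟨e⟩ := exists_algEquiv_tensor_mop (K := K) D
  have hs' : s = Module.finrank K D * Module.finrank K H := by
    rw [Module.finrank_tensorProduct, Module.finrank_tensorProduct, hHH', ← sq] at hs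
    exact Nat.pow_left_injective (n := 2) (by norm_num) hs
  let φ : (D ⊗[K] H) ⊗[K] (D ⊗[K] H')ᵐᵒᵖ →ₐ[K] Module.End K (Fin s → K) :=
    (Matrix.toLinAlgEquiv' (R := K)).toAlgHom.comp ψ
  let L : D ⊗[K] H →ₐ[K] Module.End K (Fin s → K) := φ.comp Algebra.TensorProduct.includeLeft
  let R : (D ⊗[K] H')ᵐᵒᵖ →ₐ[K] Module.End K (Fin s → K) :=
    φ.comp Algebra.TensorProduct.includeRight
  have hLR : ∀ x y, Commute (L x) (R y) := fun x y ↦ by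
    refine Commute.map ?_ φ
    simp [Commute, SemiconjBy]
  let d : D →ₐ[K] Module.End K (Fin s → K) := L.comp Algebra.TensorProduct.includeLeft
  let d' : Dᵐᵒᵖ →ₐ[K] Module.End K (Fin s → K) :=
    R.comp (AlgHom.op Algebra.TensorProduct.includeLeft)
  let k : H →ₐ[K] Module.End K (Fin s → K) := L.comp Algebra.TensorProduct.includeRight
  let k' : H'ᵐᵒᵖ →ₐ[K] Module.End K (Fin s → K) :=
    R.comp (AlgHom.op Algebra.TensorProduct.includeRight)
  have hdk : ∀ x y, Commute (d x) (k y) := fun x y ↦ by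
    refine Commute.map ?_ L
    simp [commute_iff_eq]
  have hdk' : ∀ x y, Commute (d' x) (k' y) := fun x y ↦ by
    refine Commute.map ?_ R
    apply MulOpposite.unop_injective
    simp
  let f := Algebra.TensorProduct.lift d d' (fun x y ↦ hLR _ _)
  let g := Algebra.TensorProduct.lift k k' (fun x y ↦ hLR _ _)
  have hfg : ∀ m x, Commute (f m) (g x) := fun m x ↦
    commute_lift k k' _ _ (fun y ↦ (commute_lift d d' _ _ (fun z ↦ (hdk z y).symm)
      (fun z ↦ hLR _ _) m).symm)
      (fun y ↦ (commute_lift d d' _ _ (fun z ↦ (hLR _ _).symm) (fun z ↦ (hdk' z y).symm) m).symm) x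
  have hD : 0 < Module.finrank K D := Module.finrank_pos
  obtain ⟨W, hW, hcut⟩ := exists_cut hD (f.comp e.symm.toAlgHom)
  obtain ⟨g', -⟩ := hcut _ g (fun m x ↦ hfg _ _)
  rw [Module.finrank_fin_fun] at hW
  exact exists_sq_of_action hH g' (Nat.eq_of_mul_eq_mul_left hD (hW.trans hs')) hy

/-- If `L` splits `H`, then `D` and `D ⊗ H` become equivalent over `L`. -/
theorem splitBy_tensor {L D H : Type} [Field L] [Algebra K L] [Ring D] [Algebra K D]
    [FiniteDimensional K D] [IsSimpleRing D] [Algebra.IsCentral K D] [Ring H] [Algebra K H]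
    (h : SplitBy K L H) : SplitBy K L ((D ⊗[K] H) ⊗[K] Dᵐᵒᵖ) := by
  obtain ⟨t, ht, ⟨f⟩⟩ := h
  obtain ⟨e⟩ := exists_algEquiv_tensor_mop (K := K) D
  set n := Module.finrank K D with hn
  let e₁ : (D ⊗[K] H) ⊗[K] Dᵐᵒᵖ ≃ₐ[K] H ⊗[K] (D ⊗[K] Dᵐᵒᵖ) :=
    (Algebra.TensorProduct.congr (Algebra.TensorProduct.comm K D H) AlgEquiv.refl).trans
      (Algebra.TensorProduct.assoc K K K H D Dᵐᵒᵖ)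
  let f₁ : H ⊗[K] (D ⊗[K] Dᵐᵒᵖ) →ₐ[K]
      Matrix (Fin t) (Fin t) L ⊗[K] Matrix (Fin n) (Fin n) K :=
    Algebra.TensorProduct.map f e.toAlgHom
  let e₂ : Matrix (Fin t) (Fin t) L ⊗[K] Matrix (Fin n) (Fin n) K ≃ₐ[K]
      Matrix (Fin n) (Fin n) (Matrix (Fin t) (Fin t) L) :=
    (matrixEquivTensor (Fin n) K (Matrix (Fin t) (Fin t) L)).symm
  let e₃ : Matrix (Fin n) (Fin n) (Matrix (Fin t) (Fin t) L) ≃ₐ[K]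
      Matrix (Fin n × Fin t) (Fin n × Fin t) L :=
    Matrix.compAlgEquiv (Fin n) (Fin t) L K
  let e₄ : Matrix (Fin n × Fin t) (Fin n × Fin t) L ≃ₐ[K]
      Matrix (Fin (n * t)) (Fin (n * t)) L :=
    Matrix.reindexAlgEquiv K L finProdFinEquiv
  refine ⟨n * t, ?_, ⟨e₄.toAlgHom.comp <| e₃.toAlgHom.comp <| e₂.toAlgHom.comp <|
    f₁.comp e₁.toAlgHom⟩⟩
  rw [mul_pow, ht, Module.finrank_tensorProduct, Module.finrank_tensorProduct,
    ← (MulOpposite.opLinearEquiv K (M := D)).finrank_eq, ← hn]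
  ring

end CentralSimple

namespace CentralSimple

open Quaternion

theorem eq_zero_of_sq_add_three_mul_sq {q : ℕ} [Fact q.Prime] (hq : q % 3 = 2) (hq2 : q ≠ 2)
    {x y : ZMod q} (h : x ^ 2 + 3 * y ^ 2 = 0) : x = 0 ∧ y = 0 := by
  have hqp : q.Prime := Fact.out
  have h3 : (3 : ZMod q) ≠ 0 := by
    have h : ((3 : ℕ) : ZMod q) ≠ 0 := by
      rw [Ne, ZMod.natCast_eq_zero_iff, Nat.prime_dvd_prime_iff_eq hqp Nat.prime_three]
      rintro rfl
      simp at hq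
    exact_mod_cast h
  have h2 : (2 : ZMod q) ≠ 0 := by
    have h : ((2 : ℕ) : ZMod q) ≠ 0 := by
      rwa [Ne, ZMod.natCast_eq_zero_iff, Nat.prime_dvd_prime_iff_eq hqp Nat.prime_two]
    exact_mod_cast h
  by_cases hy : y = 0
  · subst hy
    simpa using h
  exfalso
  let z := x / y
  have hz : z ^ 2 = -3 := by
    simp only [z]
    field_simp
    linear_combination h
  let w := (-1 + z) / 2
  have hw : w ^ 2 + w + 1 = 0 := by
    simp only [w]
    field_simp
    linear_combination hz
  have hw3 : w ^ 3 = 1 := by linear_combination (w - 1) * hw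
  have hw1 : w ≠ 1 := by
    intro h1
    rw [h1] at hw
    exact h3 (by linear_combination hw)
  have hw0 : w ≠ 0 := by
    intro h0
    rw [h0] at hw
    simp at hw
  have hord : orderOf w = 3 := orderOf_eq_prime hw3 hw1
  have hdvd : 3 ∣ q - 1 := hord ▸ ZMod.orderOf_dvd_card_sub_one hw0
  have := hqp.one_lt
  omega

theorem dvd_of_form_eq {q : ℕ} [Fact q.Prime] (hq : q % 3 = 2) (hq2 : q ≠ 2) {a b : ℤ}
    (h : (q : ℤ) ∣ a ^ 2 + 3 * b ^ 2) : (q : ℤ) ∣ a ∧ (q : ℤ) ∣ b := by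
  rw [← ZMod.intCast_zmod_eq_zero_iff_dvd] at h
  push_cast at h
  have := eq_zero_of_sq_add_three_mul_sq hq hq2 h
  simpa only [ZMod.intCast_zmod_eq_zero_iff_dvd] using this

theorem pow_dvd_of_form_eq {q : ℕ} [hqp : Fact q.Prime] (hq : q % 3 = 2) (hq2 : q ≠ 2) {t : ℤ}
    (ht : (q : ℤ) ∣ t - 1) (n : ℕ) : ∀ a b c d : ℤ,
    t * a ^ 2 + 3 * b ^ 2 = q * (c ^ 2 + 3 * d ^ 2) →
      (q : ℤ) ^ n ∣ a ∧ (q : ℤ) ^ n ∣ b ∧ (q : ℤ) ^ n ∣ c ∧ (q : ℤ) ^ n ∣ d := by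
  have hq0 : (q : ℤ) ≠ 0 := by exact_mod_cast hqp.out.ne_zero
  induction n with
  | zero => simp
  | succ n ih =>
    intro a b c d h
    obtain ⟨s, hs⟩ := ht
    obtain ⟨⟨a', rfl⟩, ⟨b', rfl⟩⟩ := dvd_of_form_eq hq hq2 (a := a) (b := b)
      ⟨c ^ 2 + 3 * d ^ 2 - s * a ^ 2, by linear_combination h - a ^ 2 * hs⟩
    have h1 : c ^ 2 + 3 * d ^ 2 = q * (t * a' ^ 2 + 3 * b' ^ 2) :=
      mul_left_cancel₀ hq0 (by linear_combination -h)
    obtain ⟨⟨c', rfl⟩, ⟨d', rfl⟩⟩ := dvd_of_form_eq hq hq2 (a := c) (b := d) ⟨_, h1⟩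
    have h2 : t * a' ^ 2 + 3 * b' ^ 2 = q * (c' ^ 2 + 3 * d' ^ 2) :=
      mul_left_cancel₀ hq0 (by linear_combination -h1)
    obtain ⟨h3, h4, h5, h6⟩ := ih _ _ _ _ h2
    rw [pow_succ']
    exact ⟨mul_dvd_mul_left _ h3, mul_dvd_mul_left _ h4, mul_dvd_mul_left _ h5,
      mul_dvd_mul_left _ h6⟩

theorem int_eq_zero_of_forall_pow_dvd {q : ℕ} (hq : 1 < q) {a : ℤ}
    (h : ∀ n : ℕ, (q : ℤ) ^ n ∣ a) : a = 0 := by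
  by_contra ha
  have h1 := h a.natAbs
  rw [← Int.natAbs_dvd_natAbs, Int.natAbs_pow, Int.natAbs_natCast] at h1
  exact (Nat.le_of_dvd (Int.natAbs_pos.2 ha) h1).not_gt (Nat.lt_pow_self hq)

/-- The form `t a² + 3 b² - q (c² + 3 d²)` is anisotropic over `ℚ`. -/
theorem eq_zero_of_form_eq {q : ℕ} [hqp : Fact q.Prime] (hq : q % 3 = 2) (hq2 : q ≠ 2) {t : ℤ}
    (ht : (q : ℤ) ∣ t - 1) {a b c d : ℚ} (h : t * a ^ 2 + 3 * b ^ 2 = q * (c ^ 2 + 3 * d ^ 2)) :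
    a = 0 ∧ b = 0 ∧ c = 0 ∧ d = 0 := by
  obtain ⟨N, hN⟩ := IsLocalization.exist_integer_multiples_of_finset (nonZeroDivisors ℤ)
    ({a, b, c, d} : Finset ℚ)
  have hN0 : ((N : ℤ) : ℚ) ≠ 0 := by exact_mod_cast nonZeroDivisors.coe_ne_zero N
  obtain ⟨a', ha⟩ := hN a (by simp)
  obtain ⟨b', hb⟩ := hN b (by simp)
  obtain ⟨c', hc⟩ := hN c (by simp)
  obtain ⟨d', hd⟩ := hN d (by simp)
  simp only [zsmul_eq_mul, algebraMap_int_eq, eq_intCast] at ha hb hc hd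
  have h' : t * a' ^ 2 + 3 * b' ^ 2 = q * (c' ^ 2 + 3 * d' ^ 2) := by
    have : (t * a' ^ 2 + 3 * b' ^ 2 : ℚ) = q * (c' ^ 2 + 3 * d' ^ 2) := by
      rw [ha, hb, hc, hd]
      linear_combination ((N : ℤ) : ℚ) ^ 2 * h
    exact_mod_cast this
  have hdvd := fun n ↦ pow_dvd_of_form_eq hq hq2 ht n _ _ _ _ h'
  have key : ∀ {x : ℚ} {x' : ℤ}, (x' : ℚ) = (N : ℤ) * x → (∀ n : ℕ, (q : ℤ) ^ n ∣ x') → x = 0 :=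
    fun {x x'} h1 h2 ↦ by
      rw [int_eq_zero_of_forall_pow_dvd hqp.out.one_lt h2, Int.cast_zero, zero_eq_mul] at h1
      exact h1.resolve_left hN0
  exact ⟨key ha fun n ↦ (hdvd n).1, key hb fun n ↦ (hdvd n).2.1,
    key hc fun n ↦ (hdvd n).2.2.1, key hd fun n ↦ (hdvd n).2.2.2⟩

theorem quaternion_isUnit {q : ℕ} [Fact q.Prime] (hq : q % 3 = 2) (hq2 : q ≠ 2)
    (x : ℍ[ℚ,-3,0,q]) (hx : x ≠ 0) : IsUnit x := by
  let n : ℚ := x.re ^ 2 + 3 * x.imI ^ 2 - q * (x.imJ ^ 2 + 3 * x.imK ^ 2)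
  have hn : n ≠ 0 := by
    intro h
    obtain ⟨h1, h2, h3, h4⟩ := eq_zero_of_form_eq (q := q) hq hq2 (t := 1) (by simp)
      (a := x.re) (b := x.imI) (c := x.imJ) (d := x.imK) (by push_cast; linear_combination h)
    exact hx (QuaternionAlgebra.ext h1 h2 h3 h4)
  have h1 : x * star x = n • 1 := by
    ext <;> simp [n] <;> ring
  have h2 : star x * x = n • 1 := by
    ext <;> simp [n] <;> ring
  refine ⟨⟨x, n⁻¹ • star x, ?_, ?_⟩, rfl⟩
  · rw [mul_smul_comm, h1, smul_smul, inv_mul_cancel₀ hn, one_smul]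
  · rw [smul_mul_assoc, h2, smul_smul, inv_mul_cancel₀ hn, one_smul]

theorem quaternion_isCentral {q : ℕ} (hq : q ≠ 0) : Algebra.IsCentral ℚ ℍ[ℚ,-3,0,q] := by
  refine ⟨fun x hx ↦ ?_⟩
  have hq' : (q : ℚ) ≠ 0 := by exact_mod_cast hq
  rw [Subalgebra.mem_center_iff] at hx
  have hi := hx ⟨0, 1, 0, 0⟩
  have hj := hx ⟨0, 0, 1, 0⟩
  have h1 := congrArg QuaternionAlgebra.imJ hi
  have h2 := congrArg QuaternionAlgebra.imK hi
  have h3 := congrArg QuaternionAlgebra.imK hj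
  simp at h1 h2 h3
  refine Algebra.mem_bot.2 ⟨x.re, ?_⟩
  ext <;> simp
  all_goals linarith

theorem quaternion_no_sq {q : ℕ} [Fact q.Prime] (hq : q % 3 = 2) (hq2 : q ≠ 2) {t : ℕ}
    (htp : t.Prime) (ht : (q : ℤ) ∣ t - 1) (x : ℍ[ℚ,-3,0,q]) :
    x * x ≠ algebraMap ℚ _ (t : ℚ) := by
  intro h
  have h0 := congrArg QuaternionAlgebra.re h
  have h1 := congrArg QuaternionAlgebra.imI h
  have h2 := congrArg QuaternionAlgebra.imJ h
  have h3 := congrArg QuaternionAlgebra.imK h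
  simp at h0 h1 h2 h3
  by_cases hre : x.re = 0
  · have := eq_zero_of_form_eq (q := q) hq hq2 ht (a := 1) (b := x.imI) (c := x.imJ) (d := x.imK)
      (by push_cast; rw [hre] at h0; linear_combination -h0)
    exact one_ne_zero this.1
  · have h1' : x.imI = 0 := by
      have : x.re * x.imI = 0 := by linarith
      exact (mul_eq_zero.1 this).resolve_left hre
    have h2' : x.imJ = 0 := by
      have : x.re * x.imJ = 0 := by linarith
      exact (mul_eq_zero.1 this).resolve_left hre
    have h3' : x.imK = 0 := by
      have : x.re * x.imK = 0 := by linarith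
      exact (mul_eq_zero.1 this).resolve_left hre
    rw [h1', h2', h3'] at h0
    have hsq : IsSquare ((t : ℕ) : ℚ) := ⟨x.re, by linarith⟩
    rw [Rat.isSquare_natCast_iff] at hsq
    exact htp.prime.not_isSquare hsq

theorem quaternion_splitBy {L : Type} [Field L] [Algebra ℚ L] (q : ℕ) {s : L} (hs : s ^ 2 = -3) :
    SplitBy ℚ L ℍ[ℚ,-3,0,q] := by
  let B : QuaternionAlgebra.Basis (Matrix (Fin 2) (Fin 2) L) (-3 : ℚ) 0 (q : ℚ) :=
    { i := !![s, 0; 0, -s]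
      j := !![0, q; 1, 0]
      k := !![0, s * q; -s, 0]
      i_mul_i := by
        ext a b
        fin_cases a <;> fin_cases b <;> simp [← sq s, hs] <;> simp [Algebra.smul_def]
      j_mul_j := by
        ext a b
        fin_cases a <;> fin_cases b <;> simp [Algebra.smul_def]
      i_mul_j := by
        ext a b
        fin_cases a <;> fin_cases b <;> simp
      j_mul_i := by
        ext a b
        fin_cases a <;> fin_cases b <;> simp [mul_comm] }
  refine ⟨2, ?_, ⟨QuaternionAlgebra.lift B⟩⟩
  rw [QuaternionAlgebra.finrank_eq_four]
  norm_num

end CentralSimple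

namespace CentralSimple

open Quaternion NumberField

theorem exists_primes : ∃ q : ℕ → ℕ, (∀ n, (q n).Prime ∧ q n % 3 = 2 ∧ q n ≠ 2) ∧
    ∀ m n, m < n → (q m : ℤ) ∣ (q n : ℤ) - 1 := by
  refine exists_seq_of_forall_finset_exists (fun q : ℕ ↦ q.Prime ∧ q % 3 = 2 ∧ q ≠ 2)
    (fun x y ↦ (x : ℤ) ∣ (y : ℤ) - 1) fun s hs ↦ ?_
  have hcop : Nat.Coprime 3 (∏ x ∈ s, x) := by
    refine Nat.Coprime.prod_right fun x hx ↦ ?_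
    obtain ⟨h1, h2, -⟩ := hs x hx
    refine (Nat.coprime_primes Nat.prime_three h1).2 ?_
    rintro rfl
    simp at h2
  set M := ∏ x ∈ s, x with hM
  have hM0 : M ≠ 0 := Finset.prod_ne_zero_iff.2 fun x hx ↦ (hs x hx).1.ne_zero
  obtain ⟨a, ha3, haM⟩ := Nat.chineseRemainder hcop 2 1
  have hunit : IsUnit (a : ZMod (3 * M)) := by
    rw [ZMod.isUnit_iff_coprime]
    refine Nat.Coprime.mul_right ?_ ?_
    · rw [Nat.Coprime, ha3.gcd_eq]; simp
    · rw [Nat.Coprime, haM.gcd_eq]; simp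
  have : NeZero (3 * M) := ⟨by omega⟩
  obtain ⟨r, hr, hrp, hra⟩ := Nat.forall_exists_prime_gt_and_eq_mod hunit 2
  rw [ZMod.natCast_eq_natCast_iff] at hra
  refine ⟨r, ⟨hrp, (hra.of_mul_right M).trans ha3, hr.ne'⟩, fun x hx ↦ ?_⟩
  have h1 : r ≡ 1 [MOD x] := ((hra.of_mul_left 3).trans haM).of_dvd (Finset.dvd_prod_of_mem _ hx)
  simpa using (Nat.modEq_iff_dvd.1 h1.symm)

/-- The base change of a central simple `ℚ`-algebra. -/
def baseChangeCSAlg (L D : Type) [Field L] [Algebra ℚ L] [Ring D] [Algebra ℚ D]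
    [FiniteDimensional ℚ D] [IsSimpleRing D] [Algebra.IsCentral ℚ D] : CSAlg L where
  carrier := L ⊗[ℚ] D
  finiteDimensional := inferInstance
  isSimpleRing := isSimpleRing_tensor L D
  center_le_bot := (center_baseChange L D).out

theorem isBrauerEquiv_symm {k A B : Type} [Field k] [Ring A] [Algebra k A] [Ring B] [Algebra k B]
    (h : IsBrauerEquiv k A B) : IsBrauerEquiv k B A := by
  obtain ⟨n, m, hn, hm, ⟨e⟩⟩ := h
  exact ⟨m, n, hm, hn, ⟨e.symm⟩⟩

theorem inFiber_baseChangeCSAlg_iff {L₁ L₂ D : Type} [Field L₁] [Algebra ℚ L₁]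
    [Field L₂] [Algebra ℚ L₂] [Ring D] [Algebra ℚ D] [FiniteDimensional ℚ D] [IsSimpleRing D]
    [Algebra.IsCentral ℚ D] (h : ∀ (C : Type) [Ring C] [Algebra ℚ C] [FiniteDimensional ℚ C] [IsSimpleRing C]
      [Algebra.IsCentral ℚ C], SplitBy ℚ L₁ C ↔ SplitBy ℚ L₂ C) (B : CSAlg ℚ) :
    InFiber ℚ L₁ (baseChangeCSAlg L₁ D) B ↔ InFiber ℚ L₂ (baseChangeCSAlg L₂ D) B := by
  have := B.finiteDimensional
  have := B.isSimpleRing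
  have : Algebra.IsCentral ℚ B.carrier := ⟨B.center_le_bot⟩
  have := isSimpleRing_tensor (K := ℚ) B.carrier Dᵐᵒᵖ
  have := isCentral_tensor (K := ℚ) B.carrier Dᵐᵒᵖ
  exact (isBrauerEquiv_baseChange_iff L₁ B.carrier D).trans <|
    (h _).trans (isBrauerEquiv_baseChange_iff L₂ B.carrier D).symm

theorem exists_infinite_fiber {L D : Type} [Field L] [Algebra ℚ L] [Ring D] [Algebra ℚ D]
    [FiniteDimensional ℚ D] [IsSimpleRing D] [Algebra.IsCentral ℚ D] {s : L} (hs : s ^ 2 = -3) :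
    ∃ B : ℕ → CSAlg ℚ, (∀ i, InFiber ℚ L (baseChangeCSAlg L D) (B i)) ∧
      ∀ i j, i ≠ j → ¬ IsBrauerEquiv ℚ (B i).carrier (B j).carrier := by
  obtain ⟨q, hq, hqq⟩ := exists_primes
  have hprime : ∀ n, Fact (q n).Prime := fun n ↦ ⟨(hq n).1⟩
  have hunit : ∀ n, ∀ x : ℍ[ℚ,-3,0,q n], x ≠ 0 → IsUnit x := fun n ↦
    quaternion_isUnit (hq n).2.1 (hq n).2.2
  have hcent : ∀ n, Algebra.IsCentral ℚ ℍ[ℚ,-3,0,q n] := fun n ↦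
    quaternion_isCentral (hq n).1.ne_zero
  have hsimple : ∀ n, IsSimpleRing ℍ[ℚ,-3,0,q n] := fun n ↦ isSimpleRing_of_isUnit (hunit n)
  have hne : ∀ i j, i < j → ¬ IsBrauerEquiv ℚ (D ⊗[ℚ] ℍ[ℚ,-3,0,q i]) (D ⊗[ℚ] ℍ[ℚ,-3,0,q j]) := by
    intro i j hij h
    obtain ⟨x, hx⟩ := exists_sq_of_isBrauerEquiv (hunit i)
      (by rw [QuaternionAlgebra.finrank_eq_four, QuaternionAlgebra.finrank_eq_four]) h
      (y := ⟨0, 0, 1, 0⟩) (t := (q j : ℚ)) (by ext <;> simp)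
    exact quaternion_no_sq (hq i).2.1 (hq i).2.2 (hq j).1 (hqq i j hij) x hx
  refine ⟨fun n ↦ ⟨D ⊗[ℚ] ℍ[ℚ,-3,0,q n], inferInstance, isSimpleRing_tensor _ _,
    (isCentral_tensor _ _).out⟩, fun n ↦ ?_, fun i j hij h ↦ ?_⟩
  · have := isSimpleRing_tensor (K := ℚ) D ℍ[ℚ,-3,0,q n]
    have := isCentral_tensor (K := ℚ) D ℍ[ℚ,-3,0,q n]
    exact (isBrauerEquiv_baseChange_iff L (D ⊗[ℚ] ℍ[ℚ,-3,0,q n]) D).2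
      (splitBy_tensor (quaternion_splitBy (q n) hs))
  · rcases hij.lt_or_gt with hij | hij
    · exact hne i j hij h
    · exact hne j i hij (isBrauerEquiv_symm h)

/-- Any `ℚ`-algebra structure on a number field is the canonical one. -/
theorem exists_numField (L : Type) [Field L] [CharZero L] [i : Algebra ℚ L]
    [FiniteDimensional ℚ L] : ∃ _ : NumberField L, i = DivisionRing.toRatAlgebra := by
  obtain rfl : i = DivisionRing.toRatAlgebra := Subsingleton.elim _ _
  exact ⟨⟨⟩, rfl⟩

theorem exists_numberFields (r : ℕ) [Fact r.Prime] (hr : r % 3 = 1) (hr7 : 7 < r) :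
    ∃ (L₁ L₂ : Type) (_ : Field L₁) (_ : Field L₂) (_ : NumberField L₁) (_ : NumberField L₂),
      IsEmpty (L₁ ≃+* L₂) ∧ Nonempty (L₁ →+* ℚ_[r]) ∧ Nonempty (L₂ →+* ℚ_[r]) ∧
      (∃ s : L₁, s ^ 2 = -3) ∧ ∀ (C : Type) [Ring C] [Algebra ℚ C] [FiniteDimensional ℚ C]
        [IsSimpleRing C] [Algebra.IsCentral ℚ C], SplitBy ℚ L₁ C ↔ SplitBy ℚ L₂ C := by
  obtain ⟨L₁, L₂, _, _, h1, h2, h3, h4, h5⟩ := exists_fields r hr hr7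
  obtain ⟨_, e₁⟩ := exists_numField L₁
  obtain ⟨_, e₂⟩ := exists_numField L₂
  refine ⟨L₁, L₂, inferInstance, inferInstance, inferInstance, inferInstance, h1, h2, h3, h4, ?_⟩
  rw [← e₁, ← e₂]
  exact h5

theorem exists_divisionAlgebra {p : ℕ} (hp : p.Prime) :
    ∃ r, r.Prime ∧ r % 3 = 1 ∧ 7 < r ∧ ∃ (D : Type) (_ : Ring D) (_ : Algebra ℚ D),
      FiniteDimensional ℚ D ∧ IsSimpleRing D ∧ Algebra.IsCentral ℚ D ∧ Module.finrank ℚ D = p ^ 2 ∧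
      ∀ [Fact r.Prime] (F : Type) [Field F] [Algebra ℚ F] (_ : F →+* ℚ_[r]),
        NoZeroDivisors (F ⊗[ℚ] D) := by
  obtain ⟨r, hr, hr3, hr7, K, _, _, σ, h⟩ := exists_inertCyclic hp
  have : Fact r.Prime := ⟨hr⟩
  have : NeZero p := ⟨hp.ne_zero⟩
  have hfin := finrank_cyclicAlgebra (r := r) h.pow_eq_one h.finrank_eq
  have hdom : ∀ (F : Type) [Field F] [Algebra ℚ F] (_ : F →+* ℚ_[r]),
      NoZeroDivisors (F ⊗[ℚ] cyclicAlgebra p r σ) :=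
    fun F _ _ φ ↦ noZeroDivisors_cyclicAlgebra h.pow_eq_one h.prime F φ
  have hfd : FiniteDimensional ℚ (cyclicAlgebra p r σ) :=
    Module.finite_of_finrank_pos (by rw [hfin]; exact pow_pos hp.pos 2)
  have h1 := hdom ℚ (algebraMap ℚ ℚ_[r])
  have h2 : NoZeroDivisors (cyclicAlgebra p r σ) :=
    (Algebra.TensorProduct.lid ℚ (cyclicAlgebra p r σ)).symm.injective.noZeroDivisors _
      (map_zero _) (map_mul _)
  exact ⟨r, hr, hr3, hr7, cyclicAlgebra p r σ, inferInstance, inferInstance, hfd,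
    isSimpleRing_of_isUnit fun x hx ↦ isUnit_of_noZeroDivisors (K := ℚ) hx,
    isCentral_cyclicAlgebra hp.one_lt h.pow_eq_one h.pow_ne_one h.exists_rat, hfin, hdom⟩

theorem isDivision_baseChangeCSAlg {L D : Type} [Field L] [Algebra ℚ L] [Ring D] [Algebra ℚ D]
    [FiniteDimensional ℚ D] [IsSimpleRing D] [Algebra.IsCentral ℚ D] [NoZeroDivisors (L ⊗[ℚ] D)] :
    (baseChangeCSAlg L D).IsDivision := fun x hx ↦ by
  have : Nontrivial (L ⊗[ℚ] D) := ⟨x, 0, hx⟩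
  exact isUnit_of_noZeroDivisors (K := L) (D := L ⊗[ℚ] D) hx

theorem degreeEq_baseChangeCSAlg {L D : Type} [Field L] [Algebra ℚ L] [Ring D] [Algebra ℚ D]
    [FiniteDimensional ℚ D] [IsSimpleRing D] [Algebra.IsCentral ℚ D] {p : ℕ}
    (h : Module.finrank ℚ D = p ^ 2) : (baseChangeCSAlg L D).DegreeEq p :=
  (Module.finrank_baseChange (R := L) (M' := D)).trans h

end CentralSimple

/-- For every prime `p`, there exist non-isomorphic number fields
`L₁, L₂` and central division algebras `A₁/L₁`, `A₂/L₂` of degree `p` with equal fibers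
of the restriction map over `ℚ`, such that the fiber `(Res_{L₁/ℚ})⁻¹(A₁)` contains
infinitely many pairwise non-Brauer-equivalent central simple `ℚ`-algebras. -/
theorem stmt_8 (p : ℕ) (hp : p.Prime) :
    ∃ (L₁ L₂ : NumField), IsEmpty (L₁.carrier ≃+* L₂.carrier) ∧
      ∃ (A₁ : CSAlg L₁.carrier) (A₂ : CSAlg L₂.carrier),
        A₁.IsDivision ∧ A₁.DegreeEq p ∧ A₂.IsDivision ∧ A₂.DegreeEq p ∧
        (∀ B : CSAlg ℚ, InFiber ℚ L₁.carrier A₁ B ↔ InFiber ℚ L₂.carrier A₂ B) ∧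
        ∃ B : ℕ → CSAlg ℚ,
          (∀ i, InFiber ℚ L₁.carrier A₁ (B i)) ∧
          (∀ i j, i ≠ j → ¬ IsBrauerEquiv ℚ (B i).carrier (B j).carrier) := by
  obtain ⟨r, hr, hr3, hr7, D, _, _, _, _, _, hD, hdom⟩ := CentralSimple.exists_divisionAlgebra hp
  have : Fact r.Prime := ⟨hr⟩
  obtain ⟨L₁, L₂, _, _, _, _, hne, ⟨φ₁⟩, ⟨φ₂⟩, ⟨s, hs⟩, hsplit⟩ :=
    CentralSimple.exists_numberFields r hr3 hr7
  have := hdom L₁ φ₁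
  have := hdom L₂ φ₂
  exact ⟨⟨L₁⟩, ⟨L₂⟩, hne, CentralSimple.baseChangeCSAlg L₁ D, CentralSimple.baseChangeCSAlg L₂ D,
    CentralSimple.isDivision_baseChangeCSAlg, CentralSimple.degreeEq_baseChangeCSAlg hD,
    CentralSimple.isDivision_baseChangeCSAlg, CentralSimple.degreeEq_baseChangeCSAlg hD,
    CentralSimple.inFiber_baseChangeCSAlg_iff hsplit, CentralSimple.exists_infinite_fiber hs⟩
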